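/- If μ is a centered isotropic measure on S^{n−1}, then ℓ(Z_∞(μ)) ≤ ℓ(Δ_n), W(Z_∞(μ)°) ≤ W(Δ_n°), ℓ(Z_∞(μ)°) ≥ ℓ(Δ_n°) and W(Z_∞(μ)) ≥ W(Δ_n), with equality in any one of these inequalities if and only if the support of μ consists of exactly n+1 points. -/

import Mathlib

open MeasureTheory Metric Set
open scoped RealInnerProductSpace ENNReal

noncomputable section

/-- The standard Gaussian measure `γ_n` on `ℝ^n`. -/
def gaussianM (n : ℕ) : Measure (EuclideanSpace ℝ (Fin n)) :=
  volume.withDensity fun x =>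
    ENNReal.ofReal ((2 * Real.pi) ^ (-(n : ℝ) / 2) * Real.exp (-‖x‖ ^ 2 / 2))

/-- The ℓ-norm of a convex body: `ℓ(K) = ∫ ‖x‖_K dγ_n(x)`, where `‖·‖_K` is the gauge of `K`. -/
def ellNorm (n : ℕ) (K : Set (EuclideanSpace ℝ (Fin n))) : ℝ :=
  ∫ x, gauge K x ∂(gaussianM n)

/-- The support function `h_K`. -/
def suppFn {n : ℕ} (K : Set (EuclideanSpace ℝ (Fin n))) (u : EuclideanSpace ℝ (Fin n)) : ℝ :=
  sSup ((fun y => ⟪u, y⟫) '' K)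

/-- The mean width `W(K) = (1/(n κ_n)) ∫_{S^{n-1}} (h_K(u) + h_K(-u)) du`, the integration over
the unit sphere being with respect to the (n-1)-dimensional Hausdorff measure. -/
def meanWidth (n : ℕ) (K : Set (EuclideanSpace ℝ (Fin n))) : ℝ :=
  (1 / (n * (volume (closedBall (0 : EuclideanSpace ℝ (Fin n)) 1)).toReal)) *
    ∫ u in sphere (0 : EuclideanSpace ℝ (Fin n)) 1,
      (suppFn K u + suppFn K (-u)) ∂(μH[(n : ℝ) - 1])

/-- The polar set `K° = {x : ⟨x,y⟩ ≤ 1 for all y ∈ K}`. -/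
def polarSet {n : ℕ} (K : Set (EuclideanSpace ℝ (Fin n))) : Set (EuclideanSpace ℝ (Fin n)) :=
  {x | ∀ y ∈ K, ⟪x, y⟫ ≤ 1}

/-- `w` lists the vertices of a regular simplex inscribed in the unit ball: `n+1` unit vectors
with pairwise inner products `-1/n`. -/
def IsRegVerts {n : ℕ} (w : Fin (n + 1) → EuclideanSpace ℝ (Fin n)) : Prop :=
  (∀ i, ‖w i‖ = 1) ∧ ∀ i j, i ≠ j → ⟪w i, w j⟫ = -1 / n

/-- An ellipsoid: an image of the closed Euclidean unit ball under an invertible affine map. -/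
def IsEllipsoid {n : ℕ} (D : Set (EuclideanSpace ℝ (Fin n))) : Prop :=
  ∃ f : EuclideanSpace ℝ (Fin n) ≃ᵃ[ℝ] EuclideanSpace ℝ (Fin n),
    D = f '' closedBall 0 1

/-- `D` is the Löwner ellipsoid (minimal volume ellipsoid containing) of `K`. -/
def IsLoewnerEllipsoid {n : ℕ} (D K : Set (EuclideanSpace ℝ (Fin n))) : Prop :=
  IsEllipsoid D ∧ K ⊆ D ∧ ∀ D', IsEllipsoid D' → K ⊆ D' → volume D ≤ volume D'

/-- `D` is the John ellipsoid (maximal volume ellipsoid contained in) of `K`. -/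
def IsJohnEllipsoid {n : ℕ} (D K : Set (EuclideanSpace ℝ (Fin n))) : Prop :=
  IsEllipsoid D ∧ D ⊆ K ∧ ∀ D', IsEllipsoid D' → D' ⊆ K → volume D' ≤ volume D

/-- The (topological) support of a measure: points all of whose open neighbourhoods have
positive measure. -/
def msupp {n : ℕ} (μ : Measure (EuclideanSpace ℝ (Fin n))) : Set (EuclideanSpace ℝ (Fin n)) :=
  {x | ∀ U : Set (EuclideanSpace ℝ (Fin n)), IsOpen U → x ∈ U → μ U ≠ 0}

/-- `μ` is a centered isotropic (Borel) measure on the unit sphere `S^{n-1}`. -/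
def IsCenteredIsotropic {n : ℕ} (μ : Measure (EuclideanSpace ℝ (Fin n))) : Prop :=
  msupp μ ⊆ sphere (0 : EuclideanSpace ℝ (Fin n)) 1 ∧
  (∀ x : EuclideanSpace ℝ (Fin n), ∫ u, ⟪u, x⟫ ^ 2 ∂μ = ‖x‖ ^ 2) ∧
  (∫ u, u ∂μ) = 0


section Part1
open MeasureTheory Metric Set
open scoped RealInnerProductSpace ENNReal

set_option linter.unusedSectionVars false


section Algebra

variable {V : Type*} [NormedAddCommGroup V] [InnerProductSpace ℝ V] [FiniteDimensional ℝ V]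
  {ι : Type*} [Fintype ι]

/-- A finite decomposition of the identity by unit vectors with positive weights. -/
structure IsDecomp (v : ι → V) (d : ι → ℝ) : Prop where
  pos : ∀ i, 0 < d i
  unit : ∀ i, ‖v i‖ = 1
  iso : ∀ x, ∑ i, (d i * ⟪v i, x⟫) • v i = x

variable {v : ι → V} {d : ι → ℝ}

lemma IsDecomp.inner_eq (h : IsDecomp v d) (x y : V) :
    ∑ i, d i * (⟪v i, x⟫ * ⟪v i, y⟫) = ⟪x, y⟫ := by
  conv_rhs => rw [← h.iso x]
  rw [sum_inner]
  refine Finset.sum_congr rfl fun i _ => ?_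
  rw [real_inner_smul_left]; ring

lemma IsDecomp.sq_eq (h : IsDecomp v d) (x : V) :
    ∑ i, d i * ⟪v i, x⟫ ^ 2 = ‖x‖ ^ 2 := by
  rw [← real_inner_self_eq_norm_sq, ← h.inner_eq x x]
  refine Finset.sum_congr rfl fun i _ => ?_
  ring

lemma IsDecomp.sum_eq (h : IsDecomp v d) : ∑ i, d i = Module.finrank ℝ V := by
  have b := stdOrthonormalBasis ℝ V
  have h1 : ∀ i, d i = ∑ j, d i * ⟪v i, b j⟫ ^ 2 := by
    intro i
    rw [← Finset.mul_sum]
    have := b.sum_sq_norm_inner_left (v i)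
    simp only [Real.norm_eq_abs, sq_abs] at this
    rw [this, h.unit i]; simp
  rw [Finset.sum_congr rfl fun i _ => h1 i, Finset.sum_comm]
  simp [h.sq_eq]

/-- variance identity -/
lemma IsDecomp.var_eq (h : IsDecomp v d) (a : ι → ℝ) :
    ∑ i, d i * (a i - ⟪v i, ∑ j, (d j * a j) • v j⟫) ^ 2
      = ∑ i, d i * a i ^ 2 - ‖∑ j, (d j * a j) • v j‖ ^ 2 := by
  set z := ∑ j, (d j * a j) • v j with hz
  have h2 : ∑ i, d i * (a i * ⟪v i, z⟫) = ‖z‖ ^ 2 := by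
    rw [← real_inner_self_eq_norm_sq]
    have : ⟪z, z⟫ = ⟪∑ j, (d j * a j) • v j, z⟫ := by rw [← hz]
    rw [this, sum_inner]
    refine Finset.sum_congr rfl fun i _ => ?_
    rw [real_inner_smul_left]; ring
  have h3 := h.sq_eq z
  have : ∀ i, d i * (a i - ⟪v i, z⟫) ^ 2
      = d i * a i ^ 2 - 2 * (d i * (a i * ⟪v i, z⟫)) + d i * ⟪v i, z⟫ ^ 2 := by
    intro i; ring
  simp_rw [this]
  rw [Finset.sum_add_distrib, Finset.sum_sub_distrib, ← Finset.mul_sum, h2, h3]; ring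

lemma IsDecomp.norm_sum_le (h : IsDecomp v d) (a : ι → ℝ) :
    ‖∑ j, (d j * a j) • v j‖ ^ 2 ≤ ∑ i, d i * a i ^ 2 := by
  have := h.var_eq a
  have h2 : 0 ≤ ∑ i, d i * (a i - ⟪v i, ∑ j, (d j * a j) • v j⟫) ^ 2 :=
    Finset.sum_nonneg fun i _ => mul_nonneg (h.pos i).le (sq_nonneg _)
  linarith

lemma IsDecomp.eq_of_norm_sum_eq (h : IsDecomp v d) (a : ι → ℝ)
    (he : ‖∑ j, (d j * a j) • v j‖ ^ 2 = ∑ i, d i * a i ^ 2) (i : ι) :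
    a i = ⟪v i, ∑ j, (d j * a j) • v j⟫ := by
  have := h.var_eq a
  rw [he, sub_self, Finset.sum_eq_zero_iff_of_nonneg
    (fun i _ => mul_nonneg (h.pos i).le (sq_nonneg _))] at this
  have := this i (Finset.mem_univ i)
  have h3 := (mul_eq_zero.1 this).resolve_left (h.pos i).ne'
  have := pow_eq_zero_iff (two_ne_zero) |>.1 h3
  linarith

/-- the operator `Σ d_i a_i v_i ⊗ v_i` -/
def opS (v : ι → V) (d a : ι → ℝ) : V →L[ℝ] V :=
  ∑ i, (d i * a i) • (innerSL ℝ (v i)).smulRight (v i)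

lemma opS_apply (a : ι → ℝ) (x : V) :
    opS v d a x = ∑ i, (d i * (a i * ⟪v i, x⟫)) • v i := by
  simp only [opS, _root_.sum_apply, _root_.smul_apply,
    ContinuousLinearMap.smulRight_apply, innerSL_apply_apply, smul_smul]
  refine Finset.sum_congr rfl fun i _ => ?_
  ring_nf

lemma opS_inner (a : ι → ℝ) (x y : V) :
    ⟪opS v d a x, y⟫ = ∑ i, d i * (a i * (⟪v i, x⟫ * ⟪v i, y⟫)) := by
  rw [opS_apply, sum_inner]
  refine Finset.sum_congr rfl fun i _ => ?_
  rw [real_inner_smul_left]; ring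

lemma IsDecomp.det_ge (h : IsDecomp v d) (a : ι → ℝ) (ha : ∀ i, 0 < a i) :
    ∏ i, a i ^ d i ≤ (opS v d a).det := by
  have hsymm : ((opS v d a : V →L[ℝ] V) : V →ₗ[ℝ] V).IsSymmetric := by
    intro x y
    rw [ContinuousLinearMap.coe_coe, opS_inner, real_inner_comm, opS_inner]
    refine Finset.sum_congr rfl fun i _ => ?_
    ring
  have hdet : (opS v d a).det = ∏ j, hsymm.eigenvalues rfl j := by
    have := hsymm.det_eq_prod_eigenvalues rfl
    simpa [ContinuousLinearMap.det] using this
  set b := hsymm.eigenvectorBasis rfl with hb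
  have hl : ∀ j, hsymm.eigenvalues rfl j = ∑ i, (d i * ⟪v i, b j⟫ ^ 2) * a i := by
    intro j
    have h1 := hsymm.apply_eigenvectorBasis rfl j
    have h2 : ⟪opS v d a (b j), b j⟫ = hsymm.eigenvalues rfl j := by
      have : opS v d a (b j) = (hsymm.eigenvalues rfl j) • b j := h1
      rw [this, real_inner_smul_left, real_inner_self_eq_norm_sq]
      simp
    rw [← h2, opS_inner]
    refine Finset.sum_congr rfl fun i _ => ?_
    ring
  have hge : ∀ j, ∏ i, a i ^ (d i * ⟪v i, b j⟫ ^ 2) ≤ hsymm.eigenvalues rfl j := by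
    intro j
    rw [hl j]
    refine Real.geom_mean_le_arith_mean_weighted _ _ _ (fun i _ => ?_) ?_ (fun i _ => (ha i).le)
    · exact mul_nonneg (h.pos i).le (sq_nonneg _)
    · rw [h.sq_eq]; simp
  rw [hdet]
  calc ∏ i, a i ^ d i = ∏ j, ∏ i, a i ^ (d i * ⟪v i, b j⟫ ^ 2) := by
        rw [Finset.prod_comm]
        refine Finset.prod_congr rfl fun i _ => ?_
        rw [← Real.rpow_sum_of_pos (ha i), ← Finset.mul_sum]
        have := b.sum_sq_norm_inner_left (v i)
        simp only [Real.norm_eq_abs, sq_abs] at this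
        rw [this, h.unit i]; simp
    _ ≤ _ := Finset.prod_le_prod
        (fun j _ => Finset.prod_nonneg fun i _ => Real.rpow_nonneg (ha i).le _) fun j _ => hge j

end Algebra

end Part1

section Part2
open MeasureTheory Metric Set
open scoped RealInnerProductSpace ENNReal
set_option linter.unusedSectionVars false


section Transport
open Filter Topology

/-- Gaussian density on an inner product space -/
def gd (V : Type*) [NormedAddCommGroup V] [InnerProductSpace ℝ V] (x : V) : ℝ :=
  (2 * Real.pi) ^ (-(Module.finrank ℝ V : ℝ) / 2) * Real.exp (-‖x‖ ^ 2 / 2)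

/-- Gaussian measure on an inner product space -/
def gM (V : Type*) [NormedAddCommGroup V] [InnerProductSpace ℝ V] [FiniteDimensional ℝ V]
    [MeasurableSpace V] [BorelSpace V] : Measure V :=
  volume.withDensity fun x => ENNReal.ofReal (gd V x)

variable {V : Type*} [NormedAddCommGroup V] [InnerProductSpace ℝ V] [FiniteDimensional ℝ V]
  [MeasurableSpace V] [BorelSpace V]

lemma gd_pos (x : V) : 0 < gd V x := by unfold gd; positivity

lemma continuous_gd : Continuous (gd V) := by unfold gd; fun_prop

lemma integral_gd : ∫ x, gd V x = 1 := by
  unfold gd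
  rw [integral_const_mul]
  have := GaussianFourier.integral_rexp_neg_mul_sq_norm (V := V) (b := 1 / 2) (by norm_num)
  have h2 : ∀ x : V, Real.exp (-‖x‖ ^ 2 / 2) = Real.exp (-(1/2) * ‖x‖ ^ 2) := by
    intro x; congr 1; ring
  simp_rw [h2, this]
  rw [show Real.pi / (1 / 2) = 2 * Real.pi by ring, ← Real.rpow_add (by positivity)]
  ring_nf; simp

lemma integrable_gd : Integrable (gd V) := by
  by_contra h
  have := integral_gd (V := V)
  rw [integral_undef h] at this
  norm_num at this

instance : IsProbabilityMeasure (gM V) := by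
  constructor
  rw [gM, withDensity_apply _ MeasurableSet.univ, Measure.restrict_univ,
    ← ofReal_integral_eq_lintegral_ofReal integrable_gd (ae_of_all _ fun x => (gd_pos x).le),
    integral_gd]
  simp

lemma gM_apply {s : Set V} (hs : MeasurableSet s) :
    gM V s = ∫⁻ x in s, ENNReal.ofReal (gd V x) := by
  rw [gM, withDensity_apply _ hs]

variable {ι : Type*} [Fintype ι] {v : ι → V} {d : ι → ℝ}

/-- data of a one-dimensional transport map -/
structure TrData (I : Set ℝ) (T T' : ℝ → ℝ) (c : ℝ) : Prop where
  isOpen : IsOpen I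
  cpos : 0 < c
  deriv : ∀ s ∈ I, HasDerivAt T (T' s) s
  pos : ∀ s ∈ I, 0 < T' s
  mono : StrictMonoOn T I
  eq : ∀ s ∈ I, Real.exp (-s ^ 2 / 2) = c * (Real.exp (-(T s) ^ 2 / 2) * T' s)

/-- domain of the transport -/
def trD (v : ι → V) (I : Set ℝ) : Set V := {y | ∀ i, ⟪v i, y⟫ ∈ I}

/-- the transport -/
def trT (v : ι → V) (d : ι → ℝ) (T : ℝ → ℝ) (y : V) : V := ∑ i, (d i * T ⟪v i, y⟫) • v i

variable {I : Set ℝ} {T T' : ℝ → ℝ} {c : ℝ}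

lemma isOpen_trD (h : TrData I T T' c) : IsOpen (trD v I) := by
  rw [trD, Set.ofPred_forall]
  exact isOpen_iInter_of_finite fun i => h.isOpen.preimage (by fun_prop)

lemma hasFDerivAt_inner (h : TrData I T T' c) {y : V} (hy : y ∈ trD v I) (i : ι) :
    HasFDerivAt (fun y => T ⟪v i, y⟫) (T' ⟪v i, y⟫ • innerSL ℝ (v i)) y := by
  have h1 : HasFDerivAt (fun y => ⟪v i, y⟫) (innerSL ℝ (v i)) y :=
    (innerSL ℝ (v i)).hasFDerivAt
  exact (h.deriv _ (hy i)).comp_hasFDerivAt y h1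

lemma hasFDerivAt_trT (h : TrData I T T' c) {y : V} (hy : y ∈ trD v I) :
    HasFDerivAt (trT v d T) (opS v d (fun i => T' ⟪v i, y⟫)) y := by
  have : HasFDerivAt (fun y => ∑ i, (d i * T ⟪v i, y⟫) • v i)
      (∑ i, ((d i) • (T' ⟪v i, y⟫ • innerSL ℝ (v i))).smulRight (v i)) y := by
    refine HasFDerivAt.fun_sum fun i _ => ?_
    exact ((hasFDerivAt_inner h hy i).const_mul (d i)).smul_const (v i)
  refine this.congr_fderiv ?_
  unfold opS
  refine Finset.sum_congr rfl fun i _ => ?_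
  ext x
  simp [smul_smul, mul_assoc]

lemma injOn_trT (hd : IsDecomp v d) (h : TrData I T T' c) : InjOn (trT v d T) (trD v I) := by
  intro x hx y hy hxy
  by_contra hne
  have h1 : ⟪trT v d T x - trT v d T y, x - y⟫ = 0 := by rw [hxy]; simp
  have h2 : ⟪trT v d T x - trT v d T y, x - y⟫
      = ∑ i, d i * ((T ⟪v i, x⟫ - T ⟪v i, y⟫) * (⟪v i, x⟫ - ⟪v i, y⟫)) := by
    unfold trT
    rw [← Finset.sum_sub_distrib, sum_inner]
    refine Finset.sum_congr rfl fun i _ => ?_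
    rw [← sub_smul, real_inner_smul_left, inner_sub_right]; ring
  have hnn : ∀ i, 0 ≤ d i * ((T ⟪v i, x⟫ - T ⟪v i, y⟫) * (⟪v i, x⟫ - ⟪v i, y⟫)) := by
    intro i
    refine mul_nonneg (hd.pos i).le ?_
    rcases le_total ⟪v i, x⟫ ⟪v i, y⟫ with hle | hle
    · have := (h.mono.le_iff_le (hx i) (hy i)).2 hle
      exact mul_nonneg_of_nonpos_of_nonpos (by linarith) (by linarith)
    · have := (h.mono.le_iff_le (hy i) (hx i)).2 hle
      exact mul_nonneg (by linarith) (by linarith)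
  rw [h1] at h2
  have h3 := (Finset.sum_eq_zero_iff_of_nonneg (fun i _ => hnn i)).1 h2.symm
  apply hne
  rw [← hd.iso x, ← hd.iso y]
  refine Finset.sum_congr rfl fun i hi => ?_
  have h4 := (mul_eq_zero.1 (h3 i hi)).resolve_left (hd.pos i).ne'
  have : ⟪v i, x⟫ = ⟪v i, y⟫ := by
    rcases mul_eq_zero.1 h4 with h5 | h5
    · exact h.mono.injOn (hx i) (hy i) (by linarith)
    · linarith
  rw [this]

lemma pointwise_mid (hd : IsDecomp v d) (h : TrData I T T' c) {y : V} (hy : y ∈ trD v I) :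
    Real.exp (-‖y‖ ^ 2 / 2) = c ^ (Module.finrank ℝ V) *
      (Real.exp (-(∑ i, d i * (T ⟪v i, y⟫) ^ 2) / 2) * ∏ i, (T' ⟪v i, y⟫) ^ d i) := by
  have h1 : Real.exp (-‖y‖ ^ 2 / 2) = ∏ i, (Real.exp (-⟪v i, y⟫ ^ 2 / 2)) ^ d i := by
    rw [← hd.sq_eq y]
    simp_rw [← Real.exp_mul]
    rw [← Real.exp_sum]
    congr 1
    rw [← Finset.sum_neg_distrib, Finset.sum_div]
    refine Finset.sum_congr rfl fun i _ => ?_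
    ring
  rw [h1]
  have h2 : ∀ i, (Real.exp (-⟪v i, y⟫ ^ 2 / 2)) ^ d i
      = c ^ d i * (Real.exp (-(d i * (T ⟪v i, y⟫) ^ 2) / 2) * (T' ⟪v i, y⟫) ^ d i) := by
    intro i
    rw [h.eq _ (hy i), Real.mul_rpow h.cpos.le
      (mul_nonneg (Real.exp_pos _).le (h.pos _ (hy i)).le),
      Real.mul_rpow (Real.exp_pos _).le (h.pos _ (hy i)).le, ← Real.exp_mul]
    congr 3; ring
  rw [Finset.prod_congr rfl fun i _ => h2 i, Finset.prod_mul_distrib, Finset.prod_mul_distrib,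
    ← Real.rpow_sum_of_pos h.cpos, hd.sum_eq, Real.rpow_natCast, ← Real.exp_sum]
  congr 3
  rw [← Finset.sum_neg_distrib, Finset.sum_div]

lemma pointwise_le (hd : IsDecomp v d) (h : TrData I T T' c) {y : V} (hy : y ∈ trD v I) :
    gd V y ≤ c ^ (Module.finrank ℝ V) *
      (|(opS v d (fun i => T' ⟪v i, y⟫)).det| * gd V (trT v d T y)) := by
  have hdet := hd.det_ge (fun i => T' ⟪v i, y⟫) (fun i => h.pos _ (hy i))
  have hn := hd.norm_sum_le (fun i => T ⟪v i, y⟫)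
  have hp : 0 ≤ ∏ i, (T' ⟪v i, y⟫) ^ d i :=
    Finset.prod_nonneg fun i _ => Real.rpow_nonneg (h.pos _ (hy i)).le _
  have hk : (0:ℝ) < (2 * Real.pi) ^ (-(Module.finrank ℝ V : ℝ) / 2) := by positivity
  have hc : 0 < c ^ (Module.finrank ℝ V) := pow_pos h.cpos _
  have key : Real.exp (-(∑ i, d i * (T ⟪v i, y⟫) ^ 2) / 2) * ∏ i, (T' ⟪v i, y⟫) ^ d i ≤
      Real.exp (-‖trT v d T y‖ ^ 2 / 2) * |(opS v d (fun i => T' ⟪v i, y⟫)).det| := by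
    refine mul_le_mul ?_ (hdet.trans (le_abs_self _)) hp (Real.exp_pos _).le
    apply Real.exp_le_exp.2
    unfold trT
    linarith
  unfold gd
  rw [pointwise_mid hd h hy]
  calc _ = ((2 * Real.pi) ^ (-(Module.finrank ℝ V : ℝ) / 2) * c ^ (Module.finrank ℝ V)) *
        (Real.exp (-(∑ i, d i * (T ⟪v i, y⟫) ^ 2) / 2) * ∏ i, (T' ⟪v i, y⟫) ^ d i) := by ring
    _ ≤ ((2 * Real.pi) ^ (-(Module.finrank ℝ V : ℝ) / 2) * c ^ (Module.finrank ℝ V)) *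
        (Real.exp (-‖trT v d T y‖ ^ 2 / 2) * |(opS v d (fun i => T' ⟪v i, y⟫)).det|) :=
        mul_le_mul_of_nonneg_left key (by positivity)
    _ = _ := by ring

lemma pointwise_eq (hd : IsDecomp v d) (h : TrData I T T' c) {y : V} (hy : y ∈ trD v I)
    (he : gd V y = c ^ (Module.finrank ℝ V) *
      (|(opS v d (fun i => T' ⟪v i, y⟫)).det| * gd V (trT v d T y))) :
    ‖trT v d T y‖ ^ 2 = ∑ i, d i * (T ⟪v i, y⟫) ^ 2 := by
  have hdet := hd.det_ge (fun i => T' ⟪v i, y⟫) (fun i => h.pos _ (hy i))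
  have hn := hd.norm_sum_le (fun i => T ⟪v i, y⟫)
  have hp : 0 < ∏ i, (T' ⟪v i, y⟫) ^ d i :=
    Finset.prod_pos fun i _ => Real.rpow_pos_of_pos (h.pos _ (hy i)) _
  have hk : (0:ℝ) < (2 * Real.pi) ^ (-(Module.finrank ℝ V : ℝ) / 2) := by positivity
  have hc : 0 < c ^ (Module.finrank ℝ V) := pow_pos h.cpos _
  refine le_antisymm hn ?_
  unfold gd at he
  rw [pointwise_mid hd h hy] at he
  have he2 : Real.exp (-(∑ i, d i * (T ⟪v i, y⟫) ^ 2) / 2) * ∏ i, (T' ⟪v i, y⟫) ^ d i =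
      Real.exp (-‖trT v d T y‖ ^ 2 / 2) * |(opS v d (fun i => T' ⟪v i, y⟫)).det| := by
    have hkc := (mul_pos hk hc).ne'
    apply mul_left_cancel₀ hkc
    linarith
  by_contra hlt
  push Not at hlt
  have h3 : Real.exp (-(∑ i, d i * (T ⟪v i, y⟫) ^ 2) / 2) < Real.exp (-‖trT v d T y‖ ^ 2 / 2) := by
    apply Real.exp_lt_exp.2; linarith
  have : Real.exp (-(∑ i, d i * (T ⟪v i, y⟫) ^ 2) / 2) * ∏ i, (T' ⟪v i, y⟫) ^ d i <
      Real.exp (-‖trT v d T y‖ ^ 2 / 2) * |(opS v d (fun i => T' ⟪v i, y⟫)).det| := by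
    refine mul_lt_mul h3 (hdet.trans (le_abs_self _)) hp (Real.exp_pos _).le
  linarith

lemma gM_image (hd : IsDecomp v d) (h : TrData I T T' c) :
    gM V (trT v d T '' trD v I) = ∫⁻ y in trD v I,
      ENNReal.ofReal |(opS v d (fun i => T' ⟪v i, y⟫)).det| *
        ENNReal.ofReal (gd V (trT v d T y)) := by
  have hm : MeasurableSet (trD v I) := (isOpen_trD h).measurableSet
  have hder : ∀ y ∈ trD v I,
      HasFDerivWithinAt (trT v d T) (opS v d (fun i => T' ⟪v i, y⟫)) (trD v I) y :=
    fun y hy => (hasFDerivAt_trT h hy).hasFDerivWithinAt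
  rw [gM_apply (measurable_image_of_fderivWithin hm hder (injOn_trT hd h)),
    lintegral_image_eq_lintegral_abs_det_fderiv_mul volume hm hder (injOn_trT hd h)]

lemma pointwise_le_ennreal (hd : IsDecomp v d) (h : TrData I T T' c) {y : V} (hy : y ∈ trD v I) :
    ENNReal.ofReal (gd V y) ≤ ENNReal.ofReal (c ^ (Module.finrank ℝ V)) *
      (ENNReal.ofReal |(opS v d (fun i => T' ⟪v i, y⟫)).det| *
        ENNReal.ofReal (gd V (trT v d T y))) := by
  rw [← ENNReal.ofReal_mul (abs_nonneg _), ← ENNReal.ofReal_mul (pow_pos h.cpos _).le]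
  exact ENNReal.ofReal_le_ofReal (pointwise_le hd h hy)

theorem transport_le (hd : IsDecomp v d) (h : TrData I T T' c) :
    gM V (trD v I) ≤ ENNReal.ofReal (c ^ (Module.finrank ℝ V)) * gM V (trT v d T '' trD v I) := by
  have hm : MeasurableSet (trD v I) := (isOpen_trD h).measurableSet
  rw [gM_apply hm, gM_image hd h, ← lintegral_const_mul' _ _ ENNReal.ofReal_ne_top]
  exact setLIntegral_mono' hm fun y hy => pointwise_le_ennreal hd h hy

theorem transport_eq (hd : IsDecomp v d) (h : TrData I T T' c)
    (he : ENNReal.ofReal (c ^ (Module.finrank ℝ V)) * gM V (trT v d T '' trD v I)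
      ≤ gM V (trD v I)) :
    ∀ y ∈ trD v I, ∀ i, T ⟪v i, y⟫ = ⟪v i, trT v d T y⟫ := by
  have hm : MeasurableSet (trD v I) := (isOpen_trD h).measurableSet
  have hcont : ContinuousOn (trT v d T) (trD v I) :=
    fun y hy => (hasFDerivAt_trT h hy).continuousAt.continuousWithinAt
  have hcontT : ∀ i, ContinuousOn (fun y => T ⟪v i, y⟫) (trD v I) :=
    fun i y hy => (hasFDerivAt_inner h hy i).continuousAt.continuousWithinAt
  have hder : ∀ y ∈ trD v I,
      HasFDerivWithinAt (trT v d T) (opS v d (fun i => T' ⟪v i, y⟫)) (trD v I) y :=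
    fun y hy => (hasFDerivAt_trT h hy).hasFDerivWithinAt
  have hG : AEMeasurable (fun y => ENNReal.ofReal (c ^ (Module.finrank ℝ V)) *
      (ENNReal.ofReal |(opS v d (fun i => T' ⟪v i, y⟫)).det| *
        ENNReal.ofReal (gd V (trT v d T y)))) (volume.restrict (trD v I)) := by
    refine AEMeasurable.const_mul (f := fun y =>
      (ENNReal.ofReal |(opS v d (fun i => T' ⟪v i, y⟫)).det| *
        ENNReal.ofReal (gd V (trT v d T y)))) (AEMeasurable.fun_mul ?_ ?_) _
    · exact aemeasurable_ofReal_abs_det_fderivWithin volume hm hder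
    · refine ENNReal.measurable_ofReal.comp_aemeasurable ?_
      exact (continuous_gd.comp_continuousOn hcont).aemeasurable hm
  have hfin : ∫⁻ y in trD v I, ENNReal.ofReal (gd V y) ≠ ⊤ := by
    rw [← gM_apply hm]; exact measure_ne_top _ _
  rw [gM_apply hm, gM_image hd h, ← lintegral_const_mul' _ _ ENNReal.ofReal_ne_top] at he
  have hle : (fun y => ENNReal.ofReal (gd V y)) ≤ᵐ[volume.restrict (trD v I)]
      (fun y => ENNReal.ofReal (c ^ (Module.finrank ℝ V)) *
      (ENNReal.ofReal |(opS v d (fun i => T' ⟪v i, y⟫)).det| *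
        ENNReal.ofReal (gd V (trT v d T y)))) := by
    rw [EventuallyLE, ae_restrict_iff' hm]
    exact ae_of_all _ fun y hy => pointwise_le_ennreal hd h hy
  have hae := ae_eq_of_ae_le_of_lintegral_le hle hfin hG he
  have hae2 : (fun y => ‖trT v d T y‖ ^ 2) =ᵐ[volume.restrict (trD v I)]
      fun y => ∑ i, d i * (T ⟪v i, y⟫) ^ 2 := by
    filter_upwards [hae, ae_restrict_mem hm] with y hy hyD
    rw [← ENNReal.ofReal_mul (abs_nonneg _), ← ENNReal.ofReal_mul (pow_pos h.cpos _).le,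
      ENNReal.ofReal_eq_ofReal_iff (gd_pos y).le
        (mul_nonneg (pow_pos h.cpos _).le (mul_nonneg (abs_nonneg _) (gd_pos _).le))] at hy
    exact pointwise_eq hd h hyD hy
  have hall : EqOn (fun y => ‖trT v d T y‖ ^ 2) (fun y => ∑ i, d i * (T ⟪v i, y⟫) ^ 2)
      (trD v I) := by
    refine Measure.eqOn_open_of_ae_eq hae2 (isOpen_trD h) ?_ ?_
    · exact hcont.norm.pow 2
    · exact continuousOn_finsetSum _ fun i _ => ((hcontT i).pow 2).const_mul (d i)
  intro y hy i
  exact hd.eq_of_norm_sum_eq (fun i => T ⟪v i, y⟫) (hall hy) i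

lemma symm_of_eq (h : TrData I T T' c)
    (he : ∀ y ∈ trD v I, ∀ i, T ⟪v i, y⟫ = ⟪v i, trT v d T y⟫) {y : V} (hy : y ∈ trD v I)
    (i k : ι) : T' ⟪v i, y⟫ * ⟪v i, v k⟫ = T' ⟪v k, y⟫ * ⟪v i, v k⟫ := by
  have key : ∀ i k, T' ⟪v i, y⟫ * ⟪v i, v k⟫
      = ∑ j, d j * (T' ⟪v j, y⟫ * (⟪v j, v k⟫ * ⟪v j, v i⟫)) := by
    intro i k
    have h1 := hasFDerivAt_inner h hy i
    have h2 : HasFDerivAt (fun y => ⟪v i, trT v d T y⟫)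
        ((innerSL ℝ (v i)).comp (opS v d (fun i => T' ⟪v i, y⟫))) y :=
      (innerSL ℝ (v i)).hasFDerivAt.comp y (hasFDerivAt_trT h hy)
    have h3 : (fun y => T ⟪v i, y⟫) =ᶠ[𝓝 y] fun y => ⟪v i, trT v d T y⟫ := by
      filter_upwards [(isOpen_trD h).mem_nhds hy] with z hz using he z hz i
    have h4 := (h2.congr_of_eventuallyEq h3).unique h1
    have h5 := congrArg (fun L : V →L[ℝ] ℝ => L (v k)) h4
    simp only [ContinuousLinearMap.comp_apply, innerSL_apply_apply, _root_.smul_apply,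
      smul_eq_mul] at h5
    rw [← h5, real_inner_comm, opS_inner]
  rw [key i k, real_inner_comm (v k) (v i), key k i]
  refine Finset.sum_congr rfl fun j _ => ?_
  ring

lemma not_locally_const (h : TrData I T T' c) (h0 : (0:ℝ) ∈ I) (hc : c ≠ 1)
    (hk : ∀ᶠ s in 𝓝 (0:ℝ), T' s = T' 0) : False := by
  set k := T' 0 with hkdef
  have hkpos : 0 < k := h.pos 0 h0
  -- T k = s near 0
  have h1 : ∀ᶠ s in 𝓝 (0:ℝ), T s * k = s := by
    filter_upwards [hk.eventually_nhds, h.isOpen.mem_nhds h0] with s hs hsI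
    have hT := h.deriv s hsI
    rw [hs.self_of_nhds] at hT
    have h2 : (fun s => Real.exp (-s ^ 2 / 2)) =ᶠ[𝓝 s]
        fun s => c * (Real.exp (-(T s) ^ 2 / 2) * k) := by
      filter_upwards [hs, h.isOpen.mem_nhds hsI] with r hr hrI
      rw [h.eq r hrI, hr]
    have h3 : HasDerivAt (fun s => Real.exp (-s ^ 2 / 2)) (Real.exp (-s ^ 2 / 2) * (-s)) s := by
      have : HasDerivAt (fun s : ℝ => -s ^ 2 / 2) (-s) s := by
        have := ((hasDerivAt_pow 2 s).neg).div_const 2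
        refine this.congr_deriv ?_
        norm_num; ring
      exact this.exp
    have h4 : HasDerivAt (fun s => c * (Real.exp (-(T s) ^ 2 / 2) * k))
        (c * (Real.exp (-(T s) ^ 2 / 2) * (-(T s * k)) * k)) s := by
      have : HasDerivAt (fun s : ℝ => -(T s) ^ 2 / 2) (-(T s * k)) s := by
        have := ((hT.pow 2).neg).div_const 2
        refine this.congr_deriv ?_
        simp; ring
      exact (this.exp.mul_const k).const_mul c
    have h5 := h3.unique (h4.congr_of_eventuallyEq h2)
    have h6 := h.eq s hsI
    rw [hs.self_of_nhds] at h6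
    have hpos := Real.exp_pos (-s ^ 2 / 2)
    have h7 : Real.exp (-s ^ 2 / 2) * (-s) = Real.exp (-s ^ 2 / 2) * (-(T s * k)) := by
      rw [h5]; rw [h6]; ring
    have := mul_left_cancel₀ hpos.ne' h7
    linarith
  have hT0 : T 0 = 0 := by
    have := h1.self_of_nhds
    simpa [hkpos.ne'] using this
  have h2 : HasDerivAt (fun s => T s * k) (k * k) 0 := (h.deriv 0 h0).mul_const k
  have h3 : HasDerivAt (fun s : ℝ => s) 1 0 := hasDerivAt_id 0
  have h4 := h2.unique (h3.congr_of_eventuallyEq h1)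
  have hk1 : k = 1 := by nlinarith
  have h5 := h.eq 0 h0
  rw [hT0, ← hkdef, hk1] at h5
  simp at h5
  exact hc h5.symm

theorem transport_orth (hd : IsDecomp v d) (h : TrData I T T' c) (h0 : (0:ℝ) ∈ I) (hc : c ≠ 1)
    (he : ENNReal.ofReal (c ^ (Module.finrank ℝ V)) * gM V (trT v d T '' trD v I)
      ≤ gM V (trD v I)) (i k : ι) (hik : ⟪v i, v k⟫ ^ 2 < 1) : ⟪v i, v k⟫ = 0 := by
  by_contra hne
  have heq := transport_eq hd h he
  have hD0 : (0 : V) ∈ trD v I := fun j => by simpa using h0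
  have hconst : ∀ y ∈ trD v I, T' ⟪v i, y⟫ = T' ⟪v k, y⟫ := fun y hy =>
    mul_right_cancel₀ hne (symm_of_eq h heq hy i k)
  set ρ := ⟪v i, v k⟫ with hρ
  set a : V := (1 - ρ ^ 2)⁻¹ • (v i - ρ • v k) with ha
  have hvv : ∀ j, ⟪v j, v j⟫ = 1 := fun j => by rw [real_inner_self_eq_norm_sq, hd.unit]; simp
  have ha1 : ⟪v i, a⟫ = 1 := by
    rw [ha, inner_smul_right, inner_sub_right, inner_smul_right, hvv, ← hρ]
    have : 1 - ρ ^ 2 ≠ 0 := by linarith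
    field_simp
  have ha2 : ⟪v k, a⟫ = 0 := by
    rw [ha, inner_smul_right, inner_sub_right, inner_smul_right, hvv, real_inner_comm, ← hρ]
    simp
  refine not_locally_const h h0 hc ?_
  have htend : Tendsto (fun s : ℝ => s • a) (𝓝 0) (𝓝 0) := by
    have : Continuous fun s : ℝ => s • a := by fun_prop
    simpa using this.tendsto 0
  filter_upwards [htend ((isOpen_trD h).mem_nhds hD0)] with s hs
  have := hconst _ hs
  simpa [inner_smul_right, ha1, ha2] using this

end Transport

end Part2

section Part3
open MeasureTheory Metric Set
open scoped RealInnerProductSpace ENNReal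
set_option linter.unusedSectionVars false


section OneDim
open Filter Topology

/-- the standard normal distribution function -/
def Ph (t : ℝ) : ℝ := ∫ x in Iic t, gd ℝ x

lemma Ph_sub (s t : ℝ) : Ph t - Ph s = ∫ x in s..t, gd ℝ x :=
  intervalIntegral.integral_Iic_sub_Iic integrable_gd.integrableOn integrable_gd.integrableOn

lemma Ph_deriv (t : ℝ) : HasDerivAt Ph (gd ℝ t) t := by
  have h1 : HasDerivAt (fun u => ∫ x in (0:ℝ)..u, gd ℝ x) (gd ℝ t) t :=
    intervalIntegral.integral_hasDerivAt_right (continuous_gd.intervalIntegrable _ _)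
      (continuous_gd.stronglyMeasurableAtFilter _ _) continuous_gd.continuousAt
  have h2 : Ph = fun u => Ph 0 + ∫ x in (0:ℝ)..u, gd ℝ x := by
    funext u; rw [← Ph_sub]; ring
  rw [h2]
  exact h1.const_add _

lemma Ph_strictMono : StrictMono Ph :=
  strictMono_of_deriv_pos fun x => by rw [(Ph_deriv x).deriv]; exact gd_pos x

lemma Ph_cont : Continuous Ph := continuous_iff_continuousAt.2 fun t => (Ph_deriv t).continuousAt

lemma Ph_tendsto_top : Tendsto Ph atTop (𝓝 1) := by
  have h1 := intervalIntegral_tendsto_integral_Ioi (f := gd ℝ) (μ := volume) 0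
    integrable_gd.integrableOn tendsto_id
  have h2 : Ph = fun u => Ph 0 + ∫ x in (0:ℝ)..u, gd ℝ x := by
    funext u; rw [← Ph_sub]; ring
  rw [h2]
  have h3 : Ph 0 + ∫ x in Ioi (0:ℝ), gd ℝ x = 1 := by
    rw [Ph, intervalIntegral.integral_Iic_add_Ioi integrable_gd.integrableOn
      integrable_gd.integrableOn, integral_gd]
  rw [← h3]
  exact h1.const_add _

lemma Ph_tendsto_bot : Tendsto Ph atBot (𝓝 0) := by
  have h1 := intervalIntegral_tendsto_integral_Iic (f := gd ℝ) (μ := volume) 0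
    integrable_gd.integrableOn tendsto_id
  have h2 : Ph = fun u => Ph 0 - ∫ x in u..(0:ℝ), gd ℝ x := by
    funext u; rw [← Ph_sub]; ring
  rw [h2]
  have := h1.const_sub (Ph 0)
  rw [Ph] at this ⊢
  simpa using this

lemma Ph_pos (t : ℝ) : 0 < Ph t := by
  have h1 : 0 ≤ Ph (t - 1) := setIntegral_nonneg measurableSet_Iic fun x _ => (gd_pos x).le
  have := Ph_strictMono (sub_one_lt t)
  linarith

lemma Ph_lt_one (t : ℝ) : Ph t < 1 := by
  have h1 : Ph (t + 1) ≤ 1 := Ph_strictMono.monotone.ge_of_tendsto Ph_tendsto_top _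
  have := Ph_strictMono (lt_add_one t)
  linarith

lemma Ph_surj {u : ℝ} (hu : u ∈ Ioo (0:ℝ) 1) : ∃ s, Ph s = u := by
  obtain ⟨a, ha⟩ := (Ph_tendsto_bot.eventually (gt_mem_nhds hu.1)).exists
  obtain ⟨b, hb⟩ := (Ph_tendsto_top.eventually (lt_mem_nhds hu.2)).exists
  exact mem_range_of_exists_le_of_exists_ge Ph_cont ⟨a, ha.le⟩ ⟨b, hb.le⟩

/-- quantile function -/
def Qu : ℝ → ℝ := Function.invFun Ph

lemma Qu_Ph (s : ℝ) : Qu (Ph s) = s := Function.leftInverse_invFun Ph_strictMono.injective s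

lemma Ph_Qu {u : ℝ} (hu : u ∈ Ioo (0:ℝ) 1) : Ph (Qu u) = u := by
  obtain ⟨s, rfl⟩ := Ph_surj hu
  rw [Qu_Ph]

lemma Qu_strictMonoOn : StrictMonoOn Qu (Ioo 0 1) := by
  intro a ha b hb hab
  rw [← Ph_strictMono.lt_iff_lt, Ph_Qu ha, Ph_Qu hb]; exact hab

lemma Qu_deriv {u : ℝ} (hu : u ∈ Ioo (0:ℝ) 1) : HasDerivAt Qu (gd ℝ (Qu u))⁻¹ u := by
  refine HasDerivAt.of_local_left_inverse ?_ (Ph_deriv (Qu u)) (gd_pos _).ne' ?_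
  · refine continuousAt_of_monotoneOn_of_image_mem_nhds Qu_strictMonoOn.monotoneOn
      (isOpen_Ioo.mem_nhds hu) ?_
    have : Qu '' Ioo 0 1 = univ := by
      refine eq_univ_of_forall fun s => ⟨Ph s, ⟨Ph_pos s, Ph_lt_one s⟩, Qu_Ph s⟩
    rw [this]; exact univ_mem
  · filter_upwards [isOpen_Ioo.mem_nhds hu] with w hw using Ph_Qu hw

lemma gd_real (s : ℝ) : gd ℝ s = gd ℝ 0 * Real.exp (-s ^ 2 / 2) := by
  unfold gd; simp

lemma trData_Ph {c : ℝ} (hc : 0 < c) : TrData {s | Ph s < c} (fun s => Qu (Ph s / c))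
    (fun s => (gd ℝ (Qu (Ph s / c)))⁻¹ * (gd ℝ s / c)) c := by
  have hmem : ∀ s ∈ {s | Ph s < c}, Ph s / c ∈ Ioo (0:ℝ) 1 := fun s hs =>
    ⟨div_pos (Ph_pos s) hc, (div_lt_one hc).2 hs⟩
  refine ⟨isOpen_lt Ph_cont continuous_const, hc, ?_, ?_, ?_, ?_⟩
  · intro s hs
    exact HasDerivAt.comp s (Qu_deriv (hmem s hs)) ((Ph_deriv s).div_const c)
  · intro s hs
    exact mul_pos (inv_pos.2 (gd_pos _)) (div_pos (gd_pos _) hc)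
  · intro a ha b hb hab
    refine Qu_strictMonoOn (hmem a ha) (hmem b hb) ?_
    exact div_lt_div_of_pos_right (Ph_strictMono hab) hc
  · intro s hs
    have h0 := gd_pos (0:ℝ)
    rw [gd_real s, gd_real (Qu _)]
    have := Real.exp_pos (-(Qu (Ph s / c)) ^ 2 / 2)
    field_simp

variable {V : Type*} [NormedAddCommGroup V] [InnerProductSpace ℝ V] [FiniteDimensional ℝ V]
  [MeasurableSpace V] [BorelSpace V]
variable {ι : Type*} [Fintype ι] {v : ι → V} {d : ι → ℝ}

/-- direct Brascamp-Lieb for half lines -/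
theorem BL_le (hd : IsDecomp v d) (t : ℝ) :
    gM V {y | ∀ i, ⟪v i, y⟫ < t} ≤ ENNReal.ofReal (Ph t ^ (Module.finrank ℝ V)) := by
  have h := trData_Ph (Ph_pos t)
  have h1 := transport_le hd h
  have h2 : trD v {s | Ph s < Ph t} = {y | ∀ i, ⟪v i, y⟫ < t} := by
    ext y; simp [trD, Ph_strictMono.lt_iff_lt]
  rw [h2] at h1
  refine h1.trans ?_
  calc _ ≤ ENNReal.ofReal (Ph t ^ (Module.finrank ℝ V)) * 1 := by gcongr; exact prob_le_one
    _ = _ := mul_one _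

theorem BL_eq (hd : IsDecomp v d) {t : ℝ} (ht : 0 < t)
    (he : ENNReal.ofReal (Ph t ^ (Module.finrank ℝ V)) ≤ gM V {y | ∀ i, ⟪v i, y⟫ < t})
    (i k : ι) (hik : ⟪v i, v k⟫ ^ 2 < 1) : ⟪v i, v k⟫ = 0 := by
  have h := trData_Ph (Ph_pos t)
  have h2 : trD v {s | Ph s < Ph t} = {y | ∀ i, ⟪v i, y⟫ < t} := by
    ext y; simp [trD, Ph_strictMono.lt_iff_lt]
  refine transport_orth hd h (Ph_strictMono ht) (Ph_lt_one t).ne ?_ i k hik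
  rw [h2]
  refine le_trans ?_ he
  calc _ ≤ ENNReal.ofReal (Ph t ^ (Module.finrank ℝ V)) * 1 := by gcongr; exact prob_le_one
    _ = _ := mul_one _

lemma RBL_aux (t : ℝ) (S : Set V) (hS : ∀ θ : ι → ℝ, (∀ i, θ i < t) → ∑ i, (d i * θ i) • v i ∈ S) :
    trD v {s | Ph s < (Ph t)⁻¹} = univ ∧
    trT v d (fun s => Qu (Ph s / (Ph t)⁻¹)) '' trD v {s | Ph s < (Ph t)⁻¹} ⊆ S := by
  have hF := Ph_pos t
  have hF1 := Ph_lt_one t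
  constructor
  · refine eq_univ_of_forall fun y i => ?_
    have : 1 < (Ph t)⁻¹ := (one_lt_inv₀ hF).2 hF1
    exact (Ph_lt_one _).trans this
  · rintro _ ⟨y, -, rfl⟩
    refine hS _ fun i => ?_
    have hp := Ph_pos ⟪v i, y⟫
    have hp1 := Ph_lt_one ⟪v i, y⟫
    rw [← Ph_strictMono.lt_iff_lt, Ph_Qu]
    · rw [div_inv_eq_mul]; nlinarith
    · rw [div_inv_eq_mul]; constructor <;> nlinarith

/-- reverse Brascamp-Lieb for half lines -/
theorem RBL_ge (hd : IsDecomp v d) (t : ℝ) (S : Set V)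
    (hS : ∀ θ : ι → ℝ, (∀ i, θ i < t) → ∑ i, (d i * θ i) • v i ∈ S) :
    ENNReal.ofReal (Ph t ^ (Module.finrank ℝ V)) ≤ gM V S := by
  have hF := Ph_pos t
  have h := trData_Ph (inv_pos.2 hF)
  obtain ⟨h2, h3⟩ := RBL_aux t S hS
  have h1 := transport_le hd h
  rw [h2, measure_univ] at h1
  rw [h2] at h3
  have h4 := h1.trans (mul_le_mul_right (measure_mono h3) _)
  calc ENNReal.ofReal (Ph t ^ (Module.finrank ℝ V))
      = ENNReal.ofReal (Ph t ^ (Module.finrank ℝ V)) * 1 := (mul_one _).symm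
    _ ≤ ENNReal.ofReal (Ph t ^ (Module.finrank ℝ V)) *
        (ENNReal.ofReal ((Ph t)⁻¹ ^ (Module.finrank ℝ V)) * gM V S) := mul_le_mul_right h4 _
    _ = gM V S := by
        rw [← mul_assoc, ← ENNReal.ofReal_mul (by positivity), ← mul_pow,
          mul_inv_cancel₀ hF.ne']
        simp

theorem RBL_eq (hd : IsDecomp v d) {t : ℝ} (S : Set V)
    (hS : ∀ θ : ι → ℝ, (∀ i, θ i < t) → ∑ i, (d i * θ i) • v i ∈ S)
    (he : gM V S ≤ ENNReal.ofReal (Ph t ^ (Module.finrank ℝ V)))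
    (i k : ι) (hik : ⟪v i, v k⟫ ^ 2 < 1) : ⟪v i, v k⟫ = 0 := by
  have hF := Ph_pos t
  have hF1 := Ph_lt_one t
  have h := trData_Ph (inv_pos.2 hF)
  obtain ⟨h2, h3⟩ := RBL_aux t S hS
  have h01 : 1 < (Ph t)⁻¹ := (one_lt_inv₀ hF).2 hF1
  refine transport_orth hd h ((Ph_lt_one _).trans h01) h01.ne' ?_ i k hik
  have h4 := (measure_mono h3).trans he
  rw [h2] at h4 ⊢
  rw [measure_univ]
  refine (mul_le_mul_right h4 _).trans ?_
  rw [← ENNReal.ofReal_mul (by positivity), ← mul_pow, inv_mul_cancel₀ hF.ne']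
  simp

end OneDim

end Part3

section Part4
open MeasureTheory Metric Set
open scoped RealInnerProductSpace ENNReal
set_option linter.unusedSectionVars false


section Prob
open Filter Topology

lemma dominance {Ω : Type*} [MeasurableSpace Ω] {P : Measure Ω} [IsProbabilityMeasure P]
    {Y₁ Y₂ : Ω → ℝ} (h₁ : Integrable Y₁ P) (h₂ : Integrable Y₂ P)
    (m₁ : Measurable Y₁) (m₂ : Measurable Y₂)
    (h : ∀ τ, P {ω | τ < Y₁ ω} ≤ P {ω | τ ≤ Y₂ ω}) :
    ∫ ω, Y₁ ω ∂P ≤ ∫ ω, Y₂ ω ∂P ∧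
    (∫ ω, Y₁ ω ∂P = ∫ ω, Y₂ ω ∂P → ∃ τ > 0, P {ω | τ < Y₁ ω} = P {ω | τ ≤ Y₂ ω}) := by
  have hneg : ∀ τ, P {ω | Y₂ ω < τ} ≤ P {ω | Y₁ ω ≤ τ} := by
    intro τ
    have e1 : {ω | Y₂ ω < τ} = {ω | τ ≤ Y₂ ω}ᶜ := by ext; simp
    have e2 : {ω | Y₁ ω ≤ τ} = {ω | τ < Y₁ ω}ᶜ := by ext; simp
    rw [e1, e2, prob_compl_eq_one_sub (measurableSet_le measurable_const m₂),
      prob_compl_eq_one_sub (measurableSet_lt measurable_const m₁)]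
    exact tsub_le_tsub_left (h τ) 1
  have hfin : ∀ {Y : Ω → ℝ}, Integrable Y P → ∫⁻ ω, ENNReal.ofReal (Y ω) ∂P ≠ ⊤ := by
    intro Y hY
    exact (hY.lintegral_lt_top).ne
  have cake_lt : ∀ {Y : Ω → ℝ}, Measurable Y → ∫⁻ ω, ENNReal.ofReal (Y ω) ∂P
      = ∫⁻ τ in Ioi (0:ℝ), P {ω | τ < Y ω} := by
    intro Y mY
    have := lintegral_eq_lintegral_meas_lt P (f := fun ω => max (Y ω) 0)
      (ae_of_all _ fun ω => le_max_right _ _) (mY.max measurable_const).aemeasurable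
    simp only [ENNReal.ofReal_max, ENNReal.ofReal_zero] at this
    rw [show (fun ω => ENNReal.ofReal (Y ω)) = fun ω => max (ENNReal.ofReal (Y ω)) 0 by
      funext; simp] at *
    rw [this]
    refine setLIntegral_congr_fun measurableSet_Ioi fun τ hτ => ?_
    have hτ' : ¬ τ < 0 := not_lt.2 (le_of_lt hτ)
    simp [lt_max_iff, hτ']
  have cake_le : ∀ {Y : Ω → ℝ}, Measurable Y → ∫⁻ ω, ENNReal.ofReal (Y ω) ∂P
      = ∫⁻ τ in Ioi (0:ℝ), P {ω | τ ≤ Y ω} := by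
    intro Y mY
    have := lintegral_eq_lintegral_meas_le P (f := fun ω => max (Y ω) 0)
      (ae_of_all _ fun ω => le_max_right _ _) (mY.max measurable_const).aemeasurable
    simp only [ENNReal.ofReal_max, ENNReal.ofReal_zero] at this
    rw [show (fun ω => ENNReal.ofReal (Y ω)) = fun ω => max (ENNReal.ofReal (Y ω)) 0 by
      funext; simp] at *
    rw [this]
    refine setLIntegral_congr_fun measurableSet_Ioi fun τ hτ => ?_
    have hτ' : ¬ τ ≤ 0 := not_le.2 hτ
    simp [le_max_iff, hτ']
  have hP : ∫⁻ ω, ENNReal.ofReal (Y₁ ω) ∂P ≤ ∫⁻ ω, ENNReal.ofReal (Y₂ ω) ∂P := by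
    rw [cake_lt m₁, cake_le m₂]
    exact lintegral_mono fun τ => h τ
  have hN : ∫⁻ ω, ENNReal.ofReal (-Y₂ ω) ∂P ≤ ∫⁻ ω, ENNReal.ofReal (-Y₁ ω) ∂P := by
    rw [cake_lt (Y := fun ω => -Y₂ ω) m₂.neg, cake_le (Y := fun ω => -Y₁ ω) m₁.neg]
    refine lintegral_mono fun τ => ?_
    have := hneg (-τ)
    convert this using 3
    · ext ω; exact lt_neg
    · ext ω; exact le_neg
  rw [integral_eq_lintegral_pos_part_sub_lintegral_neg_part h₁,
    integral_eq_lintegral_pos_part_sub_lintegral_neg_part h₂]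
  have hPr := ENNReal.toReal_mono (hfin h₂) hP
  have hNr := ENNReal.toReal_mono (hfin (Y := fun ω => -Y₁ ω) h₁.neg) hN
  refine ⟨by linarith, fun he => ?_⟩
  have hPe : ∫⁻ ω, ENNReal.ofReal (Y₂ ω) ∂P ≤ ∫⁻ ω, ENNReal.ofReal (Y₁ ω) ∂P := by
    rw [← ENNReal.toReal_le_toReal (hfin h₂) (hfin h₁)]
    linarith
  have hf1 := hfin h₁
  rw [cake_lt m₁] at hPe hf1
  rw [cake_le m₂] at hPe
  have hanti : Antitone fun τ => P {ω | τ ≤ Y₂ ω} := fun a b hab =>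
    measure_mono fun ω hω => le_trans hab hω
  have hae := ae_eq_of_ae_le_of_lintegral_le (ae_of_all _ h) hf1 hanti.measurable.aemeasurable hPe
  have hpos : (volume.restrict (Ioi (0:ℝ))) ≠ 0 := by
    rw [Ne, Measure.restrict_eq_zero]; simp
  have : NeBot (ae (volume.restrict (Ioi (0:ℝ)))) := ae_neBot.2 hpos
  obtain ⟨τ, hτ, hτ0⟩ := (hae.and (ae_restrict_mem measurableSet_Ioi)).exists
  exact ⟨τ, hτ0, hτ⟩

variable {V : Type*} [NormedAddCommGroup V] [InnerProductSpace ℝ V] [FiniteDimensional ℝ V]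
  [MeasurableSpace V] [BorelSpace V]

lemma integrable_norm_gM : Integrable (fun x : V => ‖x‖) (gM V) := by
  rw [gM, integrable_withDensity_iff_integrable_smul' (by
    exact ENNReal.measurable_ofReal.comp continuous_gd.measurable) (by simp)]
  have h1 : Integrable (fun x : V => Real.exp (-(1/4) * ‖x‖ ^ 2)) := by
    by_contra h
    have := GaussianFourier.integral_rexp_neg_mul_sq_norm (V := V) (b := 1 / 4) (by norm_num)
    rw [integral_undef h] at this
    have h2 : 0 < (Real.pi / (1 / 4)) ^ ((Module.finrank ℝ V : ℝ) / 2) := by positivity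
    linarith
  refine (h1.const_mul ((2 * Real.pi) ^ (-(Module.finrank ℝ V : ℝ) / 2))).mono' ?_ ?_
  · refine Measurable.aestronglyMeasurable ?_
    have := continuous_gd (V := V) |>.measurable
    simp only [smul_eq_mul]
    fun_prop
  · refine ae_of_all _ fun x => ?_
    rw [ENNReal.toReal_ofReal (gd_pos x).le, norm_smul, Real.norm_of_nonneg (gd_pos x).le, norm_norm,
      gd, mul_assoc]
    refine mul_le_mul_of_nonneg_left ?_ (by positivity)
    have h2 : ‖x‖ ≤ Real.exp (‖x‖ ^ 2 / 4) := by
      have := Real.add_one_le_exp (‖x‖ ^ 2 / 4)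
      nlinarith [sq_nonneg (‖x‖ / 2 - 1)]
    calc _ ≤ Real.exp (-‖x‖ ^ 2 / 2) * Real.exp (‖x‖ ^ 2 / 4) :=
          mul_le_mul_of_nonneg_left h2 (Real.exp_pos _).le
      _ = _ := by rw [← Real.exp_add]; congr 1; ring

lemma integrable_of_bound {f : V → ℝ} (hf : Continuous f) {C : ℝ} (h : ∀ x, |f x| ≤ C * ‖x‖) :
    Integrable f (gM V) :=
  (integrable_norm_gM.const_mul C).mono' hf.aestronglyMeasurable (ae_of_all _ h)

lemma gM_neg : (gM V).map (fun x => -x) = gM V := by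
  ext s hs
  rw [Measure.map_apply measurable_neg hs, gM_apply hs, gM_apply (measurable_neg hs),
    ← (Measure.measurePreserving_neg (volume : Measure V)).setLIntegral_comp_preimage hs
    (f := fun x => ENNReal.ofReal (gd V x)) (by
      exact ENNReal.measurable_ofReal.comp continuous_gd.measurable)]
  simp [gd]

lemma integral_gM_neg (f : V → ℝ) (hf : Continuous f) :
    ∫ x, f (-x) ∂(gM V) = ∫ x, f x ∂(gM V) := by
  conv_rhs => rw [← gM_neg, integral_map measurable_neg.aemeasurable hf.aestronglyMeasurable]

variable {E : Type*} [NormedAddCommGroup E] [InnerProductSpace ℝ E] [FiniteDimensional ℝ E]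
  [MeasurableSpace E] [BorelSpace E]

lemma finrank_lift : Module.finrank ℝ (WithLp 2 (E × ℝ)) = Module.finrank ℝ E + 1 := by
  rw [(WithLp.linearEquiv 2 ℝ (E × ℝ)).finrank_eq]
  simp

lemma gd_lift (y : WithLp 2 (E × ℝ)) : gd _ y = gd E y.fst * gd ℝ y.snd := by
  unfold gd
  rw [finrank_lift, WithLp.prod_norm_sq_eq_of_L2]
  have : Real.exp (-(‖y.fst‖ ^ 2 + ‖y.snd‖ ^ 2) / 2)
      = Real.exp (-‖y.fst‖ ^ 2 / 2) * Real.exp (-‖y.snd‖ ^ 2 / 2) := by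
    rw [← Real.exp_add]; congr 1; ring
  rw [this]
  have h2 : (2 * Real.pi) ^ (-((Module.finrank ℝ E + 1 : ℕ) : ℝ) / 2)
     = (2 * Real.pi) ^ (-(Module.finrank ℝ E : ℝ) / 2) *
      (2 * Real.pi) ^ (-(Module.finrank ℝ ℝ : ℝ) / 2) := by
    rw [← Real.rpow_add (by positivity)]; congr 1; simp; ring
  rw [h2]; ring

lemma mp_lift : MeasurePreserving (WithLp.ofLp : WithLp 2 (E × ℝ) → E × ℝ)
    (gM (WithLp 2 (E × ℝ))) ((gM E).prod (gM ℝ)) := by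
  have hmp := WithLp.volume_preserving_ofLp E ℝ
  refine ⟨hmp.measurable, ?_⟩
  have h2 : (gM E).prod (gM ℝ) = (volume : Measure (E × ℝ)).withDensity
      (fun z => ENNReal.ofReal (gd E z.1) * ENNReal.ofReal (gd ℝ z.2)) := by
    have m1 : Measurable fun x : E => ENNReal.ofReal (gd E x) :=
      ENNReal.measurable_ofReal.comp continuous_gd.measurable
    have m2 : Measurable fun x : ℝ => ENNReal.ofReal (gd ℝ x) :=
      ENNReal.measurable_ofReal.comp continuous_gd.measurable
    unfold gM
    rw [prod_withDensity m1 m2]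
    rfl
  rw [h2]
  ext s hs
  have m1 : Measurable fun x : E => ENNReal.ofReal (gd E x) :=
      ENNReal.measurable_ofReal.comp continuous_gd.measurable
  have m2 : Measurable fun x : ℝ => ENNReal.ofReal (gd ℝ x) :=
      ENNReal.measurable_ofReal.comp continuous_gd.measurable
  have m3 : Measurable fun z : E × ℝ => ENNReal.ofReal (gd E z.1) * ENNReal.ofReal (gd ℝ z.2) :=
    (m1.comp measurable_fst).mul (m2.comp measurable_snd)
  have h4 := hmp.setLIntegral_comp_preimage hs m3
  have h5 : ∀ y : WithLp 2 (E × ℝ), ENNReal.ofReal (gd _ y)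
      = ENNReal.ofReal (gd E y.ofLp.1) * ENNReal.ofReal (gd ℝ y.ofLp.2) := by
    intro y
    have h6 := ENNReal.ofReal_mul (q := gd ℝ y.snd) (gd_pos y.fst).le
    rw [← gd_lift y] at h6
    exact h6
  rw [Measure.map_apply hmp.measurable hs, gM_apply (hmp.measurable hs), withDensity_apply _ hs,
    ← h4]
  exact lintegral_congr fun y => h5 y

/-- The random variable `s + q(x)`. -/
def Yq (q : E → ℝ) (y : WithLp 2 (E × ℝ)) : ℝ := y.snd + q y.fst

lemma measurable_Yq {q : E → ℝ} (hq : Continuous q) : Measurable (Yq q) := by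
  have : Continuous (Yq q) := by
    unfold Yq
    have h1 : Continuous fun y : WithLp 2 (E × ℝ) => y.fst := WithLp.prod_continuous_ofLp 2 E ℝ |>.fst
    have h2 : Continuous fun y : WithLp 2 (E × ℝ) => y.snd := WithLp.prod_continuous_ofLp 2 E ℝ |>.snd
    fun_prop
  exact this.measurable

lemma integrable_snd_aux : Integrable (fun z : E × ℝ => z.2) ((gM E).prod (gM ℝ)) := by
  have : Integrable (fun s : ℝ => s) (gM ℝ) :=
    integrable_of_bound continuous_id (C := 1) (by intro x; simp)
  exact this.comp_snd (gM E)

lemma integrable_Yq {q : E → ℝ} (hi : Integrable q (gM E)) : Integrable (Yq q) (gM _) := by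
  have h1 : Integrable (fun z : E × ℝ => z.2 + q z.1) ((gM E).prod (gM ℝ)) :=
    integrable_snd_aux.add (hi.comp_fst (gM ℝ))
  exact mp_lift.integrable_comp_of_integrable h1

lemma integral_Yq {q : E → ℝ} (hi : Integrable q (gM E)) :
    ∫ y, Yq q y ∂(gM _) = ∫ x, q x ∂(gM E) := by
  have hmp := mp_lift (E := E)
  have h1 : ∫ y, Yq q y ∂(gM (WithLp 2 (E × ℝ)))
      = ∫ z : E × ℝ, (z.2 + q z.1) ∂((gM E).prod (gM ℝ)) := by
    have := hmp.integral_comp (MeasurableEquiv.toLp 2 (E × ℝ)).symm.measurableEmbedding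
      (fun z : E × ℝ => z.2 + q z.1)
    exact this
  rw [h1, integral_add integrable_snd_aux (hi.comp_fst (gM ℝ)), integral_fun_fst]
  have h2 := integral_fun_snd (μ := gM E) (ν := gM ℝ) (fun s : ℝ => s)
  rw [h2]
  have h0 : ∫ s : ℝ, s ∂(gM ℝ) = 0 := by
    have := integral_gM_neg (V := ℝ) (fun s => s) continuous_id
    rw [integral_neg] at this
    linarith
  simp [h0]

end Prob

end Part4

section Part5
open MeasureTheory Metric Set
open scoped RealInnerProductSpace ENNReal
set_option linter.unusedSectionVars false


section Lift
open Filter Topology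

/-- Euclidean space -/
abbrev EE (n : ℕ) := EuclideanSpace ℝ (Fin n)

/-- the lifted space -/
abbrev VV (n : ℕ) := WithLp 2 (EE n × ℝ)

variable {n : ℕ} {ι : Type*} [Fintype ι] {u : ι → EE n} {c : ι → ℝ} {Z : Set (EE n)}

/-- `Z` contains a centered decomposition of the identity. -/
structure Good (Z : Set (EE n)) (u : ι → EE n) (c : ι → ℝ) : Prop where
  dec : IsDecomp u c
  cen : ∑ i, c i • u i = 0
  mem : ∀ i, u i ∈ Z
  conv : Convex ℝ Z
  cpt : IsCompact Z
  sub : Z ⊆ closedBall 0 1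

/-- lifted vectors -/
def lv (u : ι → EE n) (i : ι) : VV n :=
  WithLp.toLp 2 (√((n : ℝ) / (n + 1)) • u i, √(1 / ((n : ℝ) + 1)))

/-- lifted weights -/
def ld (n : ℕ) (c : ι → ℝ) (i : ι) : ℝ := ((n : ℝ) + 1) / n * c i

lemma inner_lv (i : ι) (y : VV n) :
    ⟪lv u i, y⟫ = √((n : ℝ) / (n + 1)) * ⟪u i, y.fst⟫ + √(1 / ((n : ℝ) + 1)) * y.snd := by
  rw [WithLp.prod_inner_apply]
  simp [lv, inner_smul_left, mul_comm]

lemma inner_lv_lv (i k : ι) :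
    ⟪lv u i, lv u k⟫ = ((n : ℝ) / (n + 1)) * ⟪u i, u k⟫ + 1 / ((n : ℝ) + 1) := by
  rw [inner_lv]
  have h1 : (lv u k).fst = √((n : ℝ) / (n + 1)) • u k := rfl
  have h2 : (lv u k).snd = √(1 / ((n : ℝ) + 1)) := rfl
  rw [h1, h2, inner_smul_right, ← mul_assoc, Real.mul_self_sqrt (by positivity),
    Real.mul_self_sqrt (by positivity)]

lemma sum_lv_fst (a : ι → ℝ) : (∑ i, a i • lv u i).fst
    = √((n : ℝ) / (n + 1)) • ∑ i, a i • u i := by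
  have : ∀ y : VV n, y.fst = (WithLp.fstₗ 2 ℝ (EE n) ℝ) y := fun _ => rfl
  rw [this, map_sum, Finset.smul_sum]
  refine Finset.sum_congr rfl fun i _ => ?_
  rw [map_smul, ← this]
  exact smul_comm _ _ _

lemma sum_lv_snd (a : ι → ℝ) : (∑ i, a i • lv u i).snd
    = √(1 / ((n : ℝ) + 1)) * ∑ i, a i := by
  have : ∀ y : VV n, y.snd = (WithLp.sndₗ 2 ℝ (EE n) ℝ) y := fun _ => rfl
  rw [this, map_sum, Finset.mul_sum]
  refine Finset.sum_congr rfl fun i _ => ?_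
  rw [map_smul, ← this]
  simp [lv, mul_comm]

lemma IsDecomp.sum_c (h : IsDecomp u c) : ∑ i, c i = n := by
  rw [h.sum_eq]; simp

lemma sum_c_inner (hcen : ∑ i, c i • u i = 0) (x : EE n) : ∑ i, c i * ⟪u i, x⟫ = 0 := by
  have : ⟪∑ i, c i • u i, x⟫ = 0 := by rw [hcen, inner_zero_left]
  rw [sum_inner] at this
  simpa [inner_smul_left] using this

lemma isDecomp_lift (hn : 1 ≤ n) (h : IsDecomp u c) (hcen : ∑ i, c i • u i = 0) :
    IsDecomp (lv u) (ld n c) := by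
  have hn0 : (0:ℝ) < n := by exact_mod_cast hn
  refine ⟨fun i => mul_pos (by positivity) (h.pos i), fun i => ?_, fun y => ?_⟩
  · have : ‖lv u i‖ ^ 2 = 1 := by
      rw [← real_inner_self_eq_norm_sq, inner_lv_lv, real_inner_self_eq_norm_sq, h.unit i]
      field_simp
    nlinarith [norm_nonneg (lv u i)]
  · refine (WithLp.equiv 2 _).injective (Prod.ext ?_ ?_)
    · change (∑ i, (ld n c i * ⟪lv u i, y⟫) • lv u i).fst = y.fst
      rw [sum_lv_fst]
      have e : ∀ i, (ld n c i * ⟪lv u i, y⟫) • u i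
          = (((n : ℝ) + 1) / n * √((n : ℝ) / (n + 1))) • ((c i * ⟪u i, y.fst⟫) • u i)
           + (((n : ℝ) + 1) / n * √(1 / ((n : ℝ) + 1)) * y.snd) • (c i • u i) := by
        intro i
        rw [inner_lv, smul_smul, smul_smul, ← add_smul, ld]
        congr 1; ring
      rw [Finset.sum_congr rfl fun i _ => e i, Finset.sum_add_distrib, ← Finset.smul_sum,
        ← Finset.smul_sum, hcen, h.iso, smul_zero, add_zero, smul_smul]
      have : √((n : ℝ) / (n + 1)) * (((n : ℝ) + 1) / n * √((n : ℝ) / (n + 1))) = 1 := by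
        rw [mul_left_comm, Real.mul_self_sqrt (by positivity)]
        field_simp
      rw [this, one_smul]
    · change (∑ i, (ld n c i * ⟪lv u i, y⟫) • lv u i).snd = y.snd
      rw [sum_lv_snd]
      have e : ∀ i, ld n c i * ⟪lv u i, y⟫
          = (((n : ℝ) + 1) / n * √((n : ℝ) / (n + 1))) * (c i * ⟪u i, y.fst⟫)
           + (((n : ℝ) + 1) / n * √(1 / ((n : ℝ) + 1)) * y.snd) * c i := by
        intro i
        rw [inner_lv, ld]
        ring
      rw [Finset.sum_congr rfl fun i _ => e i, Finset.sum_add_distrib, ← Finset.mul_sum,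
        ← Finset.mul_sum, sum_c_inner hcen, h.sum_c, mul_zero, zero_add]
      have : √(1 / ((n : ℝ) + 1)) * √(1 / ((n : ℝ) + 1)) = 1 / ((n : ℝ) + 1) :=
        Real.mul_self_sqrt (by positivity)
      calc _ = (√(1 / ((n : ℝ) + 1)) * √(1 / ((n : ℝ) + 1))) * (((n : ℝ) + 1) / n * n) * y.snd := by
            ring
        _ = y.snd := by rw [this]; field_simp

lemma suppFn_bdd (hb : Z ⊆ closedBall 0 1) (x : EE n) :
    BddAbove ((fun y => ⟪x, y⟫) '' Z) := by
  refine ⟨‖x‖, ?_⟩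
  rintro _ ⟨y, hy, rfl⟩
  have := hb hy
  rw [mem_closedBall_zero_iff] at this
  calc ⟪x, y⟫ ≤ ‖x‖ * ‖y‖ := real_inner_le_norm _ _
    _ ≤ ‖x‖ * 1 := by gcongr
    _ = _ := mul_one _

lemma le_suppFn (hb : Z ⊆ closedBall 0 1) (x : EE n) {y : EE n} (hy : y ∈ Z) :
    ⟪x, y⟫ ≤ suppFn Z x := le_csSup (suppFn_bdd hb x) ⟨y, hy, rfl⟩

lemma suppFn_le (hne : Z.Nonempty) (x : EE n) {a : ℝ} (h : ∀ y ∈ Z, ⟪x, y⟫ ≤ a) :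
    suppFn Z x ≤ a := by
  refine csSup_le (hne.image _) ?_
  rintro _ ⟨y, hy, rfl⟩
  exact h y hy

lemma suppFn_lip (hb : Z ⊆ closedBall 0 1) (hne : Z.Nonempty) (x z : EE n) :
    suppFn Z x ≤ suppFn Z z + ‖x - z‖ := by
  refine suppFn_le hne x fun y hy => ?_
  have h1 := le_suppFn hb z hy
  have h2 := real_inner_le_norm (x - z) y
  have h3 := hb hy
  rw [mem_closedBall_zero_iff] at h3
  have h4 : ‖x - z‖ * ‖y‖ ≤ ‖x - z‖ * 1 := by gcongr
  rw [inner_sub_left] at h2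
  linarith

lemma continuous_suppFn (hb : Z ⊆ closedBall 0 1) (hne : Z.Nonempty) :
    Continuous (suppFn Z) := by
  have : LipschitzWith 1 (suppFn Z) := by
    refine LipschitzWith.of_le_add fun x z => ?_
    rw [dist_eq_norm]
    exact suppFn_lip hb hne x z
  exact this.continuous

lemma Good.nonempty (hn : 1 ≤ n) (h : Good Z u c) : Z.Nonempty := by
  have : Nonempty ι := by
    by_contra hι
    rw [not_nonempty_iff] at hι
    have := h.dec.sum_c
    rw [Finset.univ_eq_empty, Finset.sum_empty] at this
    have : (0:ℕ) = n := by exact_mod_cast this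
    omega
  exact ⟨_, h.mem (Classical.arbitrary ι)⟩

lemma Good.zero_mem (hn : 1 ≤ n) (h : Good Z u c) : (0 : EE n) ∈ Z := by
  have hn0 : (0:ℝ) < n := by exact_mod_cast hn
  have := h.conv.sum_mem (t := Finset.univ) (w := fun i => c i / n) (z := u)
    (fun i _ => div_nonneg (h.dec.pos i).le hn0.le)
    (by rw [← Finset.sum_div, h.dec.sum_c, div_self hn0.ne']) (fun i _ => h.mem i)
  have e : ∑ i, (c i / n) • u i = 0 := by
    have : ∀ i, (c i / n) • u i = (n : ℝ)⁻¹ • (c i • u i) := by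
      intro i; rw [smul_smul]; congr 1; ring
    rw [Finset.sum_congr rfl fun i _ => this i, ← Finset.smul_sum, h.cen, smul_zero]
  rwa [e] at this

/-- nonnegative combinations of the vectors lie in the dilated body -/
lemma Good.comb_mem (hn : 1 ≤ n) (h : Good Z u c) {a : ι → ℝ} (ha : ∀ i, 0 ≤ a i)
    (hs : ∑ i, a i ≤ 1) : ∑ i, a i • u i ∈ Z := by
  have h0 := h.zero_mem hn
  by_cases hs0 : ∑ i, a i = 0
  · have : ∀ i, a i = 0 := fun i =>
      (Finset.sum_eq_zero_iff_of_nonneg fun i _ => ha i).1 hs0 i (Finset.mem_univ i)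
    simpa [this] using h0
  · have hpos : 0 < ∑ i, a i := lt_of_le_of_ne (Finset.sum_nonneg fun i _ => ha i) (Ne.symm hs0)
    have h1 := h.conv.sum_mem (t := Finset.univ) (w := fun i => a i / ∑ j, a j) (z := u)
      (fun i _ => div_nonneg (ha i) hpos.le)
      (by rw [← Finset.sum_div, div_self hpos.ne']) (fun i _ => h.mem i)
    have h2 := (h.conv.starConvex h0).smul_mem h1 hpos.le hs
    rw [Finset.smul_sum] at h2
    convert h2 using 2 with i
    rw [smul_smul]; congr 1; field_simp

lemma Good.ball_sub (hn : 1 ≤ n) (h : Good Z u c) : closedBall (0 : EE n) (1 / n) ⊆ Z := by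
  have hn0 : (0:ℝ) < n := by exact_mod_cast hn
  intro x hx
  rw [mem_closedBall_zero_iff] at hx
  have key : ∑ i, (c i * (⟪u i, x⟫ + ‖x‖)) • u i = x := by
    have : ∀ i, (c i * (⟪u i, x⟫ + ‖x‖)) • u i = (c i * ⟪u i, x⟫) • u i + ‖x‖ • (c i • u i) := by
      intro i; rw [smul_smul, ← add_smul]; congr 1; ring
    rw [Finset.sum_congr rfl fun i _ => this i, Finset.sum_add_distrib, h.dec.iso,
      ← Finset.smul_sum, h.cen, smul_zero, add_zero]
  rw [← key]
  refine h.comb_mem hn (fun i => mul_nonneg (h.dec.pos i).le ?_) ?_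
  · have := abs_real_inner_le_norm (u i) x
    rw [h.dec.unit i, one_mul] at this
    linarith [neg_le_of_abs_le this]
  · have : ∀ i, c i * (⟪u i, x⟫ + ‖x‖) = c i * ⟪u i, x⟫ + ‖x‖ * c i := by intro i; ring
    rw [Finset.sum_congr rfl fun i _ => this i, Finset.sum_add_distrib, sum_c_inner h.cen,
      ← Finset.mul_sum, h.dec.sum_c, zero_add]
    calc ‖x‖ * n ≤ 1 / n * n := by gcongr
      _ = 1 := by field_simp

lemma Good.nhds (hn : 1 ≤ n) (h : Good Z u c) : Z ∈ 𝓝 (0 : EE n) := by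
  have hn0 : (0:ℝ) < n := by exact_mod_cast hn
  exact mem_of_superset (closedBall_mem_nhds _ (by positivity)) (h.ball_sub hn)

lemma Good.gauge_cont (hn : 1 ≤ n) (h : Good Z u c) : Continuous (gauge Z) :=
  continuous_gauge h.conv (h.nhds hn)

lemma Good.gauge_le (hn : 1 ≤ n) (h : Good Z u c) (x : EE n) : gauge Z x ≤ n * ‖x‖ := by
  have hn0 : (0:ℝ) < n := by exact_mod_cast hn
  by_cases hx : x = 0
  · simp [hx]
  have hxp : 0 < ‖x‖ := norm_pos_iff.2 hx
  refine gauge_le_of_mem (by positivity) ?_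
  refine ⟨(n * ‖x‖)⁻¹ • x, h.ball_sub hn ?_, ?_⟩
  · rw [mem_closedBall_zero_iff, norm_smul, norm_inv, norm_mul, norm_norm]
    simp only [RCLike.norm_natCast]
    apply le_of_eq; field_simp
  · simp only [smul_smul]
    rw [mul_inv_cancel₀ (by positivity), one_smul]

lemma Good.int_gauge (hn : 1 ≤ n) (h : Good Z u c) : Integrable (gauge Z) (gM (EE n)) :=
  integrable_of_bound (h.gauge_cont hn) (C := n) fun x => by
    rw [abs_of_nonneg (gauge_nonneg x)]; exact h.gauge_le hn x

lemma Good.suppFn_nonneg (hn : 1 ≤ n) (h : Good Z u c) (x : EE n) : 0 ≤ suppFn Z x := by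
  have := le_suppFn h.sub x (h.zero_mem hn)
  simpa using this

lemma Good.suppFn_le_norm (hn : 1 ≤ n) (h : Good Z u c) (x : EE n) : suppFn Z x ≤ ‖x‖ := by
  have h0 : suppFn Z 0 ≤ 0 := suppFn_le (h.nonempty hn) 0 (by simp)
  have := suppFn_lip h.sub (h.nonempty hn) x 0
  rw [sub_zero] at this
  linarith

lemma Good.int_supp (hn : 1 ≤ n) (h : Good Z u c) : Integrable (suppFn Z) (gM (EE n)) :=
  integrable_of_bound (continuous_suppFn h.sub (h.nonempty hn)) (C := 1) fun x => by
    rw [abs_of_nonneg (h.suppFn_nonneg hn x), one_mul]; exact h.suppFn_le_norm hn x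

/-- (B) -/
lemma Good.setB (hn : 1 ≤ n) (h : Good Z u c) (t : ℝ) :
    {y : VV n | Yq (fun x => √(n : ℝ) * suppFn Z x) y < t * √((n : ℝ) + 1)}
      ⊆ {y | ∀ i, ⟪lv u i, y⟫ < t} := by
  intro y hy i
  have hN : (0:ℝ) < √((n : ℝ) + 1) := Real.sqrt_pos.2 (by positivity)
  simp only [Set.mem_ofPred_eq, Yq] at hy
  rw [inner_lv, Real.sqrt_div (by positivity), Real.sqrt_div (by positivity), Real.sqrt_one]
  have h1 := le_suppFn h.sub y.fst (h.mem i)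
  rw [real_inner_comm] at h1
  have h2 : √(n : ℝ) * ⟪u i, y.fst⟫ ≤ √(n : ℝ) * suppFn Z y.fst := by gcongr
  rw [div_mul_eq_mul_div, div_mul_eq_mul_div, ← add_div, div_lt_iff₀ hN]
  linarith

/-- (A) -/
lemma Good.setA (hn : 1 ≤ n) (h : Good Z u c) (t : ℝ) (θ : ι → ℝ) (hθ : ∀ i, θ i < t) :
    ∑ i, (ld n c i * θ i) • lv u i ∈
      {y : VV n | Yq (fun x => gauge Z (-x) / √(n : ℝ)) y ≤ t * √((n : ℝ) + 1)} := by
  have hn0 : (0:ℝ) < n := by exact_mod_cast hn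
  have hN : (0:ℝ) < √((n : ℝ) + 1) := Real.sqrt_pos.2 (by positivity)
  have hsn : (0:ℝ) < √(n : ℝ) := Real.sqrt_pos.2 hn0
  have hN2 : √((n : ℝ) + 1) * √((n : ℝ) + 1) = n + 1 := Real.mul_self_sqrt (by positivity)
  have hn2 : √(n : ℝ) * √(n : ℝ) = n := Real.mul_self_sqrt (by positivity)
  simp only [Set.mem_ofPred_eq, Yq]
  rw [sum_lv_fst, sum_lv_snd]
  have e1 : -(√((n : ℝ) / (n + 1)) • ∑ i, (ld n c i * θ i) • u i)
      = (√((n : ℝ) / (n + 1)) * (((n : ℝ) + 1) / n)) • ∑ i, (c i * (t - θ i)) • u i := by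
    have : ∀ i, (c i * (t - θ i)) • u i = t • (c i • u i) - (c i * θ i) • u i := by
      intro i; rw [smul_smul, ← sub_smul]; congr 1; ring
    rw [Finset.sum_congr rfl fun i _ => this i, Finset.sum_sub_distrib, ← Finset.smul_sum, h.cen,
      smul_zero, zero_sub, smul_neg, mul_smul, Finset.smul_sum (r := ((n : ℝ) + 1) / n)]
    congr 2
    refine Finset.sum_congr rfl fun i _ => ?_
    rw [smul_smul, ld]; congr 1; ring
  have e2 : ∑ i, ld n c i * θ i = ((n : ℝ) + 1) / n * ∑ i, c i * θ i := by
    rw [Finset.mul_sum]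
    refine Finset.sum_congr rfl fun i _ => ?_
    rw [ld]; ring
  have e3 : ∑ i, c i * (t - θ i) = n * t - ∑ i, c i * θ i := by
    rw [← h.dec.sum_c, Finset.sum_mul, ← Finset.sum_sub_distrib]
    refine Finset.sum_congr rfl fun i _ => ?_
    ring
  have e4 : gauge Z (∑ i, (c i * (t - θ i)) • u i) ≤ n * t - ∑ i, c i * θ i := by
    rw [← e3]
    have habs : Absorbent ℝ Z := absorbent_nhds_zero (h.nhds hn)
    refine (gauge_sum_le h.conv habs _ _).trans ?_
    refine Finset.sum_le_sum fun i _ => ?_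
    have hp : 0 ≤ c i * (t - θ i) := mul_nonneg (h.dec.pos i).le (by linarith [hθ i])
    rw [gauge_smul_of_nonneg hp, smul_eq_mul]
    exact mul_le_of_le_one_right hp (gauge_le_one_of_mem (h.mem i))
  rw [e1, e2, gauge_smul_of_nonneg (by positivity), smul_eq_mul]
  set T := ∑ i, c i * θ i
  set G := gauge Z (∑ i, (c i * (t - θ i)) • u i)
  rw [Real.sqrt_div (by positivity), Real.sqrt_div (by positivity), Real.sqrt_one]
  calc 1 / √((n : ℝ) + 1) * (((n : ℝ) + 1) / n * T)
        + √(n : ℝ) / √((n : ℝ) + 1) * (((n : ℝ) + 1) / n) * G / √(n : ℝ)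
      = √((n : ℝ) + 1) / n * (T + G) := by
        field_simp
        rw [pow_two, hN2]
    _ ≤ √((n : ℝ) + 1) / n * (n * t) := by gcongr; linarith
    _ = _ := by field_simp

/-- Any two distinct lifted vectors are orthogonal: the equality condition. -/
def RegF (u : ι → EE n) : Prop := ∀ i k, u i ≠ u k → ⟪u i, u k⟫ = -1 / n

lemma reg_of_orth (hn : 1 ≤ n) (h : Good Z u c)
    (ho : ∀ i k, ⟪lv u i, lv u k⟫ ^ 2 < 1 → ⟪lv u i, lv u k⟫ = 0) : RegF u := by
  have hn0 : (0:ℝ) < n := by exact_mod_cast hn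
  intro i k hik
  have h1 : ⟪u i, u k⟫ < 1 := by
    rw [inner_lt_one_iff_real_of_norm_eq_one (h.dec.unit i) (h.dec.unit k)]; exact hik
  have h2 : -1 ≤ ⟪u i, u k⟫ := by
    have := abs_real_inner_le_norm (u i) (u k)
    rw [h.dec.unit i, h.dec.unit k, one_mul] at this
    exact neg_le_of_abs_le this
  have := ho i k (by
    rw [inner_lv_lv, sq_lt_one_iff_abs_lt_one, abs_lt]
    have hp : (0:ℝ) < n + 1 := by positivity
    constructor
    · rw [div_mul_eq_mul_div, ← add_div, lt_div_iff₀ hp]; nlinarith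
    · rw [div_mul_eq_mul_div, ← add_div, div_lt_iff₀ hp]; nlinarith)
  rw [inner_lv_lv] at this
  field_simp at this ⊢
  linarith

variable {ι' : Type*} [Fintype ι'] {u' : ι' → EE n} {c' : ι' → ℝ} {Z' : Set (EE n)}

theorem main_compare (hn : 1 ≤ n) (h : Good Z u c) (h' : Good Z' u' c') :
    ∫ x, gauge Z x ∂(gM (EE n)) ≤ n * ∫ x, suppFn Z' x ∂(gM (EE n)) ∧
    (∫ x, gauge Z x ∂(gM (EE n)) = n * ∫ x, suppFn Z' x ∂(gM (EE n)) → RegF u ∧ RegF u') := by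
  have hn0 : (0:ℝ) < n := by exact_mod_cast hn
  have hN : (0:ℝ) < √((n : ℝ) + 1) := Real.sqrt_pos.2 (by positivity)
  have hsn : (0:ℝ) < √(n : ℝ) := Real.sqrt_pos.2 hn0
  have hn2 : √(n : ℝ) * √(n : ℝ) = n := Real.mul_self_sqrt (by positivity)
  have hfr : Module.finrank ℝ (VV n) = n + 1 := by rw [finrank_lift]; simp
  set q1 : EE n → ℝ := fun x => gauge Z (-x) / √(n : ℝ) with hq1
  set q2 : EE n → ℝ := fun x => √(n : ℝ) * suppFn Z' x with hq2
  have c1 : Continuous q1 := ((h.gauge_cont hn).comp continuous_neg).div_const _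
  have c2 : Continuous q2 := continuous_const.mul (continuous_suppFn h'.sub (h'.nonempty hn))
  have i1 : Integrable q1 (gM (EE n)) := by
    refine Integrable.div_const ?_ _
    refine integrable_of_bound ((h.gauge_cont hn).comp continuous_neg) (C := n) fun x => ?_
    rw [abs_of_nonneg (gauge_nonneg _)]
    simpa using h.gauge_le hn (-x)
  have i2 : Integrable q2 (gM (EE n)) := (h'.int_supp hn).const_mul _
  have v1 : ∫ x, q1 x ∂(gM (EE n)) = (∫ x, gauge Z x ∂(gM (EE n))) / √(n : ℝ) := by
    rw [hq1, integral_div, integral_gM_neg _ (h.gauge_cont hn)]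
  have v2 : ∫ x, q2 x ∂(gM (EE n)) = √(n : ℝ) * ∫ x, suppFn Z' x ∂(gM (EE n)) := by
    rw [hq2, integral_const_mul]
  have D := isDecomp_lift hn h.dec h.cen
  have D' := isDecomp_lift hn h'.dec h'.cen
  have hA : ∀ τ, ENNReal.ofReal (Ph (τ / √((n : ℝ) + 1)) ^ (n + 1))
      ≤ gM (VV n) {y | Yq q1 y ≤ τ} := by
    intro τ
    rw [← hfr]
    refine RBL_ge D _ _ fun θ hθ => ?_
    have := h.setA hn _ θ hθ
    rwa [div_mul_cancel₀ _ hN.ne'] at this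
  have hB0 : ∀ τ, {y | Yq q2 y < τ} ⊆ {y | ∀ i, ⟪lv u' i, y⟫ < τ / √((n : ℝ) + 1)} := by
    intro τ
    have := h'.setB hn (τ / √((n : ℝ) + 1))
    rwa [div_mul_cancel₀ _ hN.ne'] at this
  have hB : ∀ τ, gM (VV n) {y | Yq q2 y < τ}
      ≤ ENNReal.ofReal (Ph (τ / √((n : ℝ) + 1)) ^ (n + 1)) := by
    intro τ
    rw [← hfr]
    exact (measure_mono (hB0 τ)).trans (BL_le D' _)
  have m1 := measurable_Yq c1
  have m2 := measurable_Yq c2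
  have E1 : ∀ τ, gM (VV n) {y | τ < Yq q1 y} = 1 - gM (VV n) {y | Yq q1 y ≤ τ} := by
    intro τ
    rw [← prob_compl_eq_one_sub (measurableSet_le m1 measurable_const)]
    congr 1; ext; simp
  have E2 : ∀ τ, gM (VV n) {y | τ ≤ Yq q2 y} = 1 - gM (VV n) {y | Yq q2 y < τ} := by
    intro τ
    rw [← prob_compl_eq_one_sub (measurableSet_lt m2 measurable_const)]
    congr 1; ext; simp
  obtain ⟨hle, heq⟩ := dominance (integrable_Yq i1) (integrable_Yq i2) m1 m2 (fun τ => by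
    rw [E1, E2]; exact tsub_le_tsub_left ((hB τ).trans (hA τ)) 1)
  rw [integral_Yq i1, integral_Yq i2, v1, v2] at hle heq
  constructor
  · rw [div_le_iff₀ hsn] at hle
    calc _ ≤ _ := hle
      _ = (√(n : ℝ) * √(n : ℝ)) * ∫ x, suppFn Z' x ∂(gM (EE n)) := by ring
      _ = _ := by rw [hn2]
  · intro he
    obtain ⟨τ, hτ, ht⟩ := heq (by
      rw [he, div_eq_iff hsn.ne']
      nth_rewrite 1 [← hn2]; ring)
    rw [E1, E2] at ht
    have hee : gM (VV n) {y | Yq q1 y ≤ τ} = gM (VV n) {y | Yq q2 y < τ} := by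
      have := congrArg (fun z => 1 - z) ht
      simpa only [ENNReal.sub_sub_cancel ENNReal.one_ne_top prob_le_one] using this
    constructor
    · refine reg_of_orth hn h fun i k hik => ?_
      refine RBL_eq D (t := τ / √((n : ℝ) + 1)) {y | Yq q1 y ≤ τ} (fun θ hθ => ?_) ?_ i k hik
      · have := h.setA hn _ θ hθ
        rwa [div_mul_cancel₀ _ hN.ne'] at this
      · rw [hfr, hee]; exact hB τ
    · refine reg_of_orth hn h' fun i k hik => ?_
      refine BL_eq D' (t := τ / √((n : ℝ) + 1)) (by positivity) ?_ i k hik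
      rw [hfr]
      exact ((hA τ).trans hee.le).trans (measure_mono (hB0 τ))

end Lift

end Part5

section Part6
open MeasureTheory Metric Set
open scoped RealInnerProductSpace ENNReal
set_option linter.unusedSectionVars false


section Discretize
open Filter Topology

lemma compact_convexHull {W : Type*} [NormedAddCommGroup W] [NormedSpace ℝ W]
    [FiniteDimensional ℝ W] {s : Set W} (hs : IsCompact s) : IsCompact (convexHull ℝ s) := by
  rcases s.eq_empty_or_nonempty with rfl | ⟨s0, hs0⟩
  · simp
  set d := Module.finrank ℝ W + 1 with hd
  have hK : IsCompact ((stdSimplex ℝ (Fin d)) ×ˢ (Set.univ.pi fun _ : Fin d => s)) :=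
    (isCompact_stdSimplex ℝ (Fin d)).prod (isCompact_univ_pi fun _ => hs)
  have hc : Continuous fun p : (Fin d → ℝ) × (Fin d → W) => ∑ j, p.1 j • p.2 j := by fun_prop
  have he : convexHull ℝ s = (fun p : (Fin d → ℝ) × (Fin d → W) => ∑ j, p.1 j • p.2 j) ''
      ((stdSimplex ℝ (Fin d)) ×ˢ (Set.univ.pi fun _ : Fin d => s)) := by
    apply Subset.antisymm
    · intro x hx
      obtain ⟨ι, hι, z, w, hz, hai, hw, hw1, hx⟩ := eq_pos_convex_span_of_mem_convexHull hx
      have hcard : Fintype.card ι ≤ Fintype.card (Fin d) := by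
        rw [Fintype.card_fin]
        exact hai.card_le_finrank_succ.trans (Nat.succ_le_succ (Submodule.finrank_le _))
      obtain ⟨e⟩ := Function.Embedding.nonempty_of_card_le hcard
      refine ⟨(Function.extend e w 0, Function.extend e z fun _ => s0), ⟨⟨fun j => ?_, ?_⟩, ?_⟩, ?_⟩
      · by_cases hj : ∃ i, e i = j
        · obtain ⟨i, rfl⟩ := hj
          simp [e.injective.extend_apply, (hw i).le]
        · simp [Function.extend_apply' _ _ _ hj]
      · rw [← hw1]
        symm
        refine Fintype.sum_of_injective e e.injective _ _ (fun j hj => ?_) fun i => ?_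
        · exact Function.extend_apply' _ _ _ hj
        · exact (e.injective.extend_apply _ _ _).symm
      · intro j _
        by_cases hj : ∃ i, e i = j
        · obtain ⟨i, rfl⟩ := hj
          simp only [e.injective.extend_apply]
          exact hz ⟨i, rfl⟩
        · simp only [Function.extend_apply' _ _ _ hj]
          exact hs0
      · rw [← hx]
        symm
        refine Fintype.sum_of_injective e e.injective _ _ (fun j hj => ?_) fun i => ?_
        · have : Function.extend e w 0 j = 0 := Function.extend_apply' _ _ _ hj
          simp [this]
        · simp [e.injective.extend_apply]
    · rintro _ ⟨⟨w, z⟩, ⟨hw, hz⟩, rfl⟩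
      exact (convex_convexHull ℝ s).sum_mem (fun i _ => hw.1 i) hw.2
        fun i _ => subset_convexHull ℝ s (hz i (Set.mem_univ i))
  rw [he]
  exact hK.image hc

variable {n : ℕ}

lemma msupp_eq (μ : Measure (EE n)) : msupp μ = μ.support := by
  rw [Measure.support_eq_forall_isOpen]
  ext x
  simp only [msupp, Set.mem_ofPred_eq]
  constructor
  · intro h U hU hx; exact pos_iff_ne_zero.2 (h U hx hU)
  · intro h U hU hx; exact (h U hx hU).ne'

variable {μ : Measure (EE n)}

lemma msupp_compact (hμ : IsCenteredIsotropic μ) : IsCompact (msupp μ) := by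
  refine (isCompact_sphere (0 : EE n) 1).of_isClosed_subset ?_ hμ.1
  rw [msupp_eq]; exact Measure.isClosed_support

lemma msupp_ae (μ : Measure (EE n)) : ∀ᵐ x ∂μ, x ∈ msupp μ := by
  rw [msupp_eq]; exact Measure.support_mem_ae

lemma exists_family (hn : 1 ≤ n) (hμ : IsCenteredIsotropic μ) :
    ∃ (ι : Type) (_ : Fintype ι) (u : ι → EE n) (c : ι → ℝ),
      Function.Injective u ∧ (∀ i, u i ∈ msupp μ) ∧ IsDecomp u c ∧ ∑ i, c i • u i = 0 := by
  have hae := msupp_ae μ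
  obtain ⟨hsph, hiso, hcen⟩ := hμ
  have hcpt := msupp_compact ⟨hsph, hiso, hcen⟩
  have hnorm : ∀ᵐ x ∂μ, ‖x‖ = 1 := hae.mono fun x hx => by simpa using hsph hx
  have hsq : ∀ x : EE n, Integrable (fun v => ⟪v, x⟫ ^ 2) μ := by
    intro x
    by_contra h
    have := hiso x
    rw [integral_undef h] at this
    have : x = 0 := by simpa using this.symm
    subst this
    simp at h
  have hfin : IsFiniteMeasure μ := by
    have h1 : Integrable (fun v : EE n => ‖v‖ ^ 2) μ := by
      have : (fun v : EE n => ‖v‖ ^ 2)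
          = fun v => ∑ i : Fin n, ⟪v, EuclideanSpace.single i (1:ℝ)⟫ ^ 2 := by
        funext v
        rw [EuclideanSpace.norm_sq_eq]
        simp [EuclideanSpace.inner_single_right]
      rw [this]
      exact integrable_finsetSum _ fun i _ => hsq _
    have h2 : Integrable (fun _ : EE n => (1:ℝ)) μ := by
      refine h1.congr (hnorm.mono fun x hx => ?_)
      simp [hx]
    exact (integrable_const_iff_isFiniteMeasure one_ne_zero).1 h2
  have hne : NeZero μ := by
    refine ⟨fun h => ?_⟩
    have := hiso (EuclideanSpace.single ⟨0, hn⟩ (1:ℝ))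
    rw [h] at this
    simp at this
  set F : EE n → (Fin n × Fin n → ℝ) × EE n := fun v => (fun p => v p.1 * v p.2, v) with hF
  have hFc : Continuous F := by
    rw [hF]
    refine Continuous.prodMk (continuous_pi fun p => ?_) continuous_id
    fun_prop
  have i1 : ∀ p : Fin n × Fin n, Integrable (fun v : EE n => v p.1 * v p.2) μ := by
    intro p
    refine Integrable.of_bound (C := 1) (Continuous.aestronglyMeasurable (by fun_prop)) ?_
    refine hnorm.mono fun x hx => ?_
    rw [norm_mul]
    have a1 := PiLp.norm_apply_le x p.1
    have a2 := PiLp.norm_apply_le x p.2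
    rw [hx] at a1 a2
    exact mul_le_one₀ a1 (norm_nonneg _) a2
  have i2 : Integrable (fun v : EE n => v) μ := by
    refine Integrable.of_bound (C := 1) continuous_id.aestronglyMeasurable ?_
    exact hnorm.mono fun x hx => hx.le
  have i3 : Integrable (fun v : EE n => fun p : Fin n × Fin n => v p.1 * v p.2) μ :=
    Integrable.of_eval i1
  have iF : Integrable F μ := i3.prodMk i2
  have hmom : ∀ p : Fin n × Fin n, ∫ v, v p.1 * v p.2 ∂μ = if p.1 = p.2 then 1 else 0 := by
    rintro ⟨i, j⟩
    have h1 := hiso (EuclideanSpace.single i (1:ℝ) + EuclideanSpace.single j (1:ℝ))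
    have h2 := hiso (EuclideanSpace.single i (1:ℝ))
    have h3 := hiso (EuclideanSpace.single j (1:ℝ))
    have e1 : ∀ v : EE n, ⟪v, EuclideanSpace.single i (1:ℝ) + EuclideanSpace.single j (1:ℝ)⟫ ^ 2
       = (v i * v i + v j * v j) + 2 * (v i * v j) := by
      intro v
      rw [inner_add_right, EuclideanSpace.inner_single_right, EuclideanSpace.inner_single_right]
      simp; ring
    have e2 : ∀ k, ∀ v : EE n, ⟪v, EuclideanSpace.single k (1:ℝ)⟫ ^ 2 = v k * v k := by
      intro k v
      rw [EuclideanSpace.inner_single_right]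
      simp; ring
    simp_rw [e1] at h1
    simp_rw [e2] at h2 h3
    have j1 : Integrable (fun v : EE n => v i * v i) μ := i1 (i, i)
    have j2 : Integrable (fun v : EE n => v j * v j) μ := i1 (j, j)
    have j3 : Integrable (fun v : EE n => 2 * (v i * v j)) μ := (i1 (i, j)).const_mul 2
    have j4 : Integrable (fun v : EE n => v i * v i + v j * v j) μ := j1.add j2
    rw [integral_add j4 j3, integral_add j1 j2, integral_const_mul, h2, h3, norm_add_sq_real] at h1
    rw [EuclideanSpace.inner_single_left] at h1
    simp only [EuclideanSpace.norm_single] at h1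
    simp only
    by_cases hij : i = j
    · subst hij
      simp at h1 ⊢; linarith
    · simp [hij] at h1 ⊢; linarith
  have hmem := (convex_convexHull ℝ (F '' msupp μ)).average_mem (μ := μ) (f := F)
    (compact_convexHull (hcpt.image hFc)).isClosed
    (hae.mono fun x hx => subset_convexHull ℝ _ ⟨x, hx, rfl⟩) iF
  obtain ⟨ι, hι, z, w, hz, hai, hw, hw1, hx⟩ := eq_pos_convex_span_of_mem_convexHull hmem
  have hz' : ∀ i, ∃ v ∈ msupp μ, F v = z i := fun i => hz ⟨i, rfl⟩
  choose u hu huz using hz'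
  set m := μ.real univ with hm
  have hm0 : 0 < m := by
    rw [hm, measureReal_def]
    exact ENNReal.toReal_pos (by simp [hne.out]) (by finiteness)
  rw [average_eq, hF, integral_pair i3 i2, hcen] at hx
  have hx1 : ∀ p : Fin n × Fin n, ∑ k, w k * (u k p.1 * u k p.2) = m⁻¹ * if p.1 = p.2 then 1 else 0 := by
    intro p
    rw [← hmom p]
    have := congrArg (fun q => q.1 p) hx
    simp only [← huz] at this
    simp only [Prod.fst_sum, Prod.smul_fst, Finset.sum_apply, Pi.smul_apply, smul_eq_mul] at this
    rw [eval_integral i1] at this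
    exact this
  have hx2 : ∑ k, w k • u k = 0 := by
    have := congrArg (fun q => q.2) hx
    simp only [← huz] at this
    simpa only [Prod.snd_sum, Prod.smul_snd, smul_zero] using this
  refine ⟨ι, hι, u, fun k => m * w k, ?_, hu, ⟨fun k => mul_pos hm0 (hw k), fun k => ?_, ?_⟩, ?_⟩
  · intro a b hab
    apply hai.injective
    rw [← huz, ← huz, hab]
  · simpa using hsph (hu k)
  · intro x
    ext j
    have e : ∀ k, ⟪u k, x⟫ = ∑ i, u k i * x i := by
      intro k; rw [PiLp.inner_apply]; simp [mul_comm]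
    have : (∑ k, (m * w k * ⟪u k, x⟫) • u k) j
        = ∑ i, x i * (m * ∑ k, w k * (u k i * u k j)) := by
      have h0 : (∑ k, (m * w k * ⟪u k, x⟫) • u k) j = ∑ k, (m * w k * ⟪u k, x⟫) * u k j := by
        simp
      rw [h0]
      simp_rw [e, Finset.mul_sum, Finset.sum_mul]
      rw [Finset.sum_comm]
      refine Finset.sum_congr rfl fun i _ => Finset.sum_congr rfl fun k _ => ?_
      ring
    rw [this]
    simp_rw [fun i => hx1 (i, j)]
    simp [hm0.ne']
  · simp_rw [mul_smul]
    rw [← Finset.smul_sum, hx2, smul_zero]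

end Discretize

end Part6

section Part7
open MeasureTheory Metric Set
open scoped RealInnerProductSpace ENNReal
set_option linter.unusedSectionVars false


section Regular
open Filter Topology

variable {n : ℕ} {ι : Type*} [Fintype ι] {u : ι → EE n} {c : ι → ℝ} {Z : Set (EE n)}

lemma finrank_VV : Module.finrank ℝ (VV n) = n + 1 := by rw [finrank_lift]; simp

lemma good_hull (hd : IsDecomp u c) (hcen : ∑ i, c i • u i = 0) {S : Set (EE n)}
    (hS : IsCompact S) (hsub : S ⊆ sphere 0 1) (hu : ∀ i, u i ∈ S) :
    Good (convexHull ℝ S) u c :=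
  ⟨hd, hcen, fun i => subset_convexHull ℝ S (hu i), convex_convexHull ℝ S, compact_convexHull hS,
    convexHull_min (hsub.trans sphere_subset_closedBall) (convex_closedBall 0 1)⟩

lemma good_range (hd : IsDecomp u c) (hcen : ∑ i, c i • u i = 0) :
    Good (convexHull ℝ (range u)) u c :=
  good_hull hd hcen (finite_range u).isCompact
    (by rintro _ ⟨i, rfl⟩; simpa using hd.unit i) fun i => ⟨i, rfl⟩

lemma reg_inner_ge (hn : 1 ≤ n) (hd : IsDecomp u c) (hr : RegF u) {y z : EE n}
    (hy : y ∈ convexHull ℝ (range u)) (hz : z ∈ convexHull ℝ (range u)) : -1 / n ≤ ⟪y, z⟫ := by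
  have hn0 : (0:ℝ) < n := by exact_mod_cast hn
  have h1 : ∀ i k, -1 / n ≤ ⟪u i, u k⟫ := by
    intro i k
    by_cases h : u i = u k
    · rw [h, real_inner_self_eq_norm_sq, hd.unit k]
      have : (-1:ℝ) / n ≤ 0 := div_nonpos_of_nonpos_of_nonneg (by norm_num) hn0.le
      linarith
    · exact (hr i k h).ge
  have hs : ∀ x : EE n, Convex ℝ {z : EE n | -1 / n ≤ ⟪x, z⟫} := by
    intro x
    exact convex_halfSpace_ge (f := fun z : EE n => ⟪x, z⟫) (innerSL ℝ x).isLinear _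
  have h2 : ∀ i, -1 / n ≤ ⟪u i, z⟫ := by
    intro i
    have : convexHull ℝ (range u) ⊆ {z : EE n | -1 / n ≤ ⟪u i, z⟫} :=
      convexHull_min (by rintro _ ⟨k, rfl⟩; exact h1 i k) (hs _)
    exact this hz
  have : convexHull ℝ (range u) ⊆ {y : EE n | -1 / n ≤ ⟪z, y⟫} :=
    convexHull_min (by rintro _ ⟨k, rfl⟩; have := h2 k; rwa [real_inner_comm] at this) (hs _)
  have := this hy
  rw [real_inner_comm]
  exact this

lemma reg_supp_le (hn : 1 ≤ n) (hd : IsDecomp u c) (hcen : ∑ i, c i • u i = 0) (hr : RegF u)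
    (x : EE n) : n * suppFn (convexHull ℝ (range u)) x ≤ gauge (convexHull ℝ (range u)) (-x) := by
  have hn0 : (0:ℝ) < n := by exact_mod_cast hn
  have hg := good_range hd hcen
  refine le_of_forall_gt_imp_ge_of_dense fun a ha => ?_
  obtain ⟨b, hb0, hba, hb⟩ := exists_lt_of_gauge_lt (absorbent_nhds_zero (hg.nhds hn)) ha
  obtain ⟨z, hz, hzx⟩ := hb
  refine le_trans ?_ hba.le
  rw [← le_div_iff₀' hn0]
  refine suppFn_le (hg.nonempty hn) x fun y hy => ?_
  have h1 := reg_inner_ge hn hd hr hz hy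
  have h2 : x = -(b • z) := by
    have : b • z = -x := hzx
    rw [this, neg_neg]
  rw [h2, inner_neg_left, inner_smul_left]
  simp only [conj_trivial]
  have : b * (-1 / n) ≤ b * ⟪z, y⟫ := mul_le_mul_of_nonneg_left h1 hb0.le
  calc -(b * ⟪z, y⟫) ≤ -(b * (-1 / n)) := by linarith
    _ = b / n := by ring

lemma reg_eq (hn : 1 ≤ n) (hd : IsDecomp u c) (hcen : ∑ i, c i • u i = 0) (hr : RegF u) :
    ∫ x, gauge (convexHull ℝ (range u)) x ∂(gM (EE n))
      = n * ∫ x, suppFn (convexHull ℝ (range u)) x ∂(gM (EE n)) := by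
  have hg := good_range hd hcen
  refine le_antisymm (main_compare hn hg hg).1 ?_
  rw [← integral_gM_neg _ (hg.gauge_cont hn), ← integral_const_mul]
  refine integral_mono ((hg.int_supp hn).const_mul _) ?_ fun x => reg_supp_le hn hd hcen hr x
  refine integrable_of_bound ((hg.gauge_cont hn).comp continuous_neg) (C := n) fun x => ?_
  rw [abs_of_nonneg (gauge_nonneg _)]
  simpa using hg.gauge_le hn (-x)

instance gM_openPos : Measure.IsOpenPosMeasure (gM (EE n)) := by
  refine Measure.AbsolutelyContinuous.isOpenPosMeasure (μ := volume) ?_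
  refine withDensity_absolutelyContinuous' ?_ ?_
  · exact (ENNReal.measurable_ofReal.comp continuous_gd.measurable).aemeasurable
  · refine ae_of_all _ fun x => ?_
    simpa using gd_pos x

lemma eq_of_integral_eq {f g : EE n → ℝ} (hf : Continuous f) (hg : Continuous g)
    (hfi : Integrable f (gM (EE n))) (hgi : Integrable g (gM (EE n))) (hle : ∀ x, f x ≤ g x)
    (he : ∫ x, f x ∂(gM (EE n)) = ∫ x, g x ∂(gM (EE n))) : f = g :=
  (hf.ae_eq_iff_eq _ hg).1 ((integral_eq_iff_of_ae_le hfi hgi (ae_of_all _ hle)).1 he)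

lemma supp_lt_of_not_mem (hn : 1 ≤ n) (hd : IsDecomp u c) (hcen : ∑ i, c i • u i = 0)
    {x : EE n} (hx : ‖x‖ = 1) (hxu : x ∉ range u) : suppFn (convexHull ℝ (range u)) x < 1 := by
  have hg := good_range hd hcen
  have hne : Nonempty ι := by
    obtain ⟨y, hy⟩ := hg.nonempty hn
    have := convexHull_nonempty_iff.1 ⟨y, hy⟩
    exact range_nonempty_iff_nonempty.1 this
  obtain ⟨k, hk⟩ := Finite.exists_max fun i => ⟪x, u i⟫
  have hlt : ⟪x, u k⟫ < 1 := by
    rw [inner_lt_one_iff_real_of_norm_eq_one hx (hd.unit k)]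
    rintro rfl
    exact hxu ⟨k, rfl⟩
  refine lt_of_le_of_lt (suppFn_le (hg.nonempty hn) x fun y hy => ?_) hlt
  have : convexHull ℝ (range u) ⊆ {z : EE n | ⟪x, z⟫ ≤ ⟪x, u k⟫} :=
    convexHull_min (by rintro _ ⟨i, rfl⟩; exact hk i)
      (convex_halfSpace_le (f := fun z : EE n => ⟪x, z⟫) (innerSL ℝ x).isLinear _)
  exact this hy

lemma span_lv (hn : 1 ≤ n) (hd : IsDecomp u c) (hcen : ∑ i, c i • u i = 0) :
    ⊤ ≤ Submodule.span ℝ (range (lv u)) := by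
  intro y _
  rw [← (isDecomp_lift hn hd hcen).iso y]
  exact Submodule.sum_mem _ fun i _ => Submodule.smul_mem _ _ (Submodule.subset_span ⟨i, rfl⟩)

lemma card_ge (hn : 1 ≤ n) (hd : IsDecomp u c) (hcen : ∑ i, c i • u i = 0) :
    n + 1 ≤ Fintype.card ι := by
  have h1 := finrank_range_le_card (R := ℝ) (lv u)
  rw [Set.finrank, top_le_iff.1 (span_lv hn hd hcen), finrank_top, finrank_VV] at h1
  exact h1

lemma orthonormal_lv (hn : 1 ≤ n) (hunit : ∀ i, ‖u i‖ = 1)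
    (hr : ∀ i k, i ≠ k → ⟪u i, u k⟫ = -1 / n) : Orthonormal ℝ (lv u) := by
  have hn0 : (0:ℝ) < n := by exact_mod_cast hn
  constructor
  · intro i
    have : ‖lv u i‖ ^ 2 = 1 := by
      rw [← real_inner_self_eq_norm_sq, inner_lv_lv, real_inner_self_eq_norm_sq, hunit i]
      field_simp
    nlinarith [norm_nonneg (lv u i)]
  · intro i k hik
    rw [inner_lv_lv, hr i k hik]
    field_simp
    ring

lemma reg_card (hn : 1 ≤ n) (hd : IsDecomp u c) (hcen : ∑ i, c i • u i = 0) (hr : RegF u)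
    (hinj : Function.Injective u) : Fintype.card ι = n + 1 := by
  refine le_antisymm ?_ (card_ge hn hd hcen)
  have := (orthonormal_lv hn hd.unit fun i k hik => hr i k (hinj.ne hik)).linearIndependent
  rw [← finrank_VV (n := n)]
  exact this.fintype_card_le_finrank

lemma reg_of_card (hn : 1 ≤ n) (hd : IsDecomp u c) (hcen : ∑ i, c i • u i = 0)
    (hcard : Fintype.card ι = n + 1) : RegF u := by
  classical
  have hn0 : (0:ℝ) < n := by exact_mod_cast hn
  have hli := linearIndependent_of_top_le_span_of_card_eq_finrank (span_lv hn hd hcen)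
    (by rw [hcard, finrank_VV])
  have hD := isDecomp_lift hn hd hcen
  intro i k hik
  have hik' : i ≠ k := fun h => hik (by rw [h])
  have h1 := hD.iso (lv u k)
  have h2 : ∑ j, (ld n c j * ⟪lv u j, lv u k⟫ - if j = k then 1 else 0) • lv u j = 0 := by
    simp_rw [sub_smul]
    rw [Finset.sum_sub_distrib, h1]
    simp
  have h3 := Fintype.linearIndependent_iff.1 hli _ h2 i
  simp only [hik', if_false, sub_zero] at h3
  have h4 : ⟪lv u i, lv u k⟫ = 0 := (mul_eq_zero.1 h3).resolve_left (hD.pos i).ne'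
  rw [inner_lv_lv] at h4
  field_simp at h4 ⊢
  linarith

lemma regVerts_decomp (hn : 1 ≤ n) {w : Fin (n + 1) → EE n} (hw : IsRegVerts w) :
    IsDecomp w (fun _ => (n : ℝ) / (n + 1)) ∧ ∑ i, ((n : ℝ) / (n + 1)) • w i = 0 ∧ RegF w := by
  have hn0 : (0:ℝ) < n := by exact_mod_cast hn
  have ho := orthonormal_lv hn hw.1 hw.2
  have hcard : Fintype.card (Fin (n + 1)) = Module.finrank ℝ (VV n) := by
    rw [finrank_VV, Fintype.card_fin]
  have hsp : ⊤ ≤ Submodule.span ℝ (range (lv w)) :=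
    (ho.linearIndependent.span_eq_top_of_card_eq_finrank hcard).ge
  have hrep : ∀ y : VV n, ∑ i, ⟪lv w i, y⟫ • lv w i = y := by
    intro y
    have := (OrthonormalBasis.mk ho hsp).sum_repr' y
    simpa using this
  have ha : 0 < √((n : ℝ) / (n + 1)) := Real.sqrt_pos.2 (by positivity)
  have hb : 0 < √(1 / ((n : ℝ) + 1)) := Real.sqrt_pos.2 (by positivity)
  have h0 : ∑ i, w i = 0 := by
    have := congrArg (fun y : VV n => y.fst) (hrep (WithLp.toLp 2 ((0 : EE n), (1:ℝ))))
    simp only [sum_lv_fst, inner_lv] at this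
    simp only [WithLp.toLp_fst, WithLp.toLp_snd, inner_zero_right, mul_zero, mul_one, zero_add] at this
    rw [← Finset.smul_sum, smul_smul] at this
    exact (smul_eq_zero.1 this).resolve_left (by positivity)
  refine ⟨⟨fun _ => by positivity, hw.1, fun x => ?_⟩, ?_, fun i k hik => hw.2 i k fun h => hik (by rw [h])⟩
  · have := congrArg (fun y : VV n => y.fst) (hrep (WithLp.toLp 2 (x, (0:ℝ))))
    simp only [sum_lv_fst, inner_lv] at this
    simp only [WithLp.toLp_fst, WithLp.toLp_snd, mul_zero, add_zero] at this
    rw [Finset.smul_sum] at this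
    conv_rhs => rw [← this]
    refine Finset.sum_congr rfl fun i _ => ?_
    rw [smul_smul, ← mul_assoc, Real.mul_self_sqrt (by positivity)]
  · rw [← Finset.smul_sum, h0, smul_zero]

/-- the comparison theorem for gauge and support function integrals -/
theorem compare_measure (hn : 1 ≤ n) {μ : Measure (EE n)} (hμ : IsCenteredIsotropic μ)
    {w : Fin (n + 1) → EE n} (hw : IsRegVerts w) :
    (∫ x, gauge (convexHull ℝ (msupp μ)) x ∂(gM (EE n))
      ≤ ∫ x, gauge (convexHull ℝ (range w)) x ∂(gM (EE n)) ∧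
     (∫ x, gauge (convexHull ℝ (msupp μ)) x ∂(gM (EE n))
      = ∫ x, gauge (convexHull ℝ (range w)) x ∂(gM (EE n)) ↔ (msupp μ).ncard = n + 1)) ∧
    (∫ x, suppFn (convexHull ℝ (range w)) x ∂(gM (EE n))
      ≤ ∫ x, suppFn (convexHull ℝ (msupp μ)) x ∂(gM (EE n)) ∧
     (∫ x, suppFn (convexHull ℝ (msupp μ)) x ∂(gM (EE n))
      = ∫ x, suppFn (convexHull ℝ (range w)) x ∂(gM (EE n)) ↔ (msupp μ).ncard = n + 1)) := by
  have hn0 : (0:ℝ) < n := by exact_mod_cast hn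
  obtain ⟨ι, hι, u, c, hinj, hmem, hd, hcen⟩ := exists_family hn hμ
  obtain ⟨wd, wcen, wr⟩ := regVerts_decomp hn hw
  have hcpt := msupp_compact hμ
  have hG := good_hull hd hcen hcpt hμ.1 hmem
  have hGu := good_range hd hcen
  have hGw := good_range wd wcen
  have ew := reg_eq hn wd wcen wr
  have k1 := main_compare hn hG hGw
  have k2 := main_compare hn hGw hG
  have hregu : RegF u →
      ∫ x, gauge (convexHull ℝ (range u)) x ∂(gM (EE n))
        = ∫ x, gauge (convexHull ℝ (range w)) x ∂(gM (EE n)) ∧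
      ∫ x, suppFn (convexHull ℝ (range u)) x ∂(gM (EE n))
        = ∫ x, suppFn (convexHull ℝ (range w)) x ∂(gM (EE n)) := by
    intro hr
    have eu := reg_eq hn hd hcen hr
    have a1 := (main_compare hn hGu hGw).1
    have a2 := (main_compare hn hGw hGu).1
    have a3 : ∫ x, gauge (convexHull ℝ (range u)) x ∂(gM (EE n))
        = ∫ x, gauge (convexHull ℝ (range w)) x ∂(gM (EE n)) := by
      apply le_antisymm
      · rw [ew]; exact a1
      · rw [eu]; exact a2
    refine ⟨a3, ?_⟩
    rw [eu, ew] at a3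
    exact mul_left_cancel₀ hn0.ne' a3
  have hrange : range u ⊆ msupp μ := by rintro _ ⟨i, rfl⟩; exact hmem i
  have hsubZ : convexHull ℝ (range u) ⊆ convexHull ℝ (msupp μ) := convexHull_mono hrange
  have hfwd : RegF u → (∀ x ∈ msupp μ, 1 ≤ suppFn (convexHull ℝ (range u)) x) →
      (msupp μ).ncard = n + 1 := by
    intro hr h1
    have : msupp μ = range u := by
      refine Subset.antisymm (fun x hx => ?_) hrange
      by_contra hxu
      have := supp_lt_of_not_mem hn hd hcen (by simpa using hμ.1 hx) hxu
      exact absurd (h1 x hx) (not_le.2 this)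
    rw [this, ← reg_card hn hd hcen hr hinj, ← image_univ, ncard_image_of_injective _ hinj,
      ncard_univ, Nat.card_eq_fintype_card]
  have hbwd : (msupp μ).ncard = n + 1 → RegF u ∧ msupp μ = range u := by
    intro hN
    have hfin : (msupp μ).Finite := finite_of_ncard_ne_zero (by omega)
    have hr1 : (range u).ncard = Fintype.card ι := by
      rw [← image_univ, ncard_image_of_injective _ hinj, ncard_univ, Nat.card_eq_fintype_card]
    have hc1 := card_ge hn hd hcen
    have : range u = msupp μ := eq_of_subset_of_ncard_le hrange (by omega) hfin
    refine ⟨reg_of_card hn hd hcen ?_, this.symm⟩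
    rw [← hr1, this, hN]
  refine ⟨⟨?_, ?_, ?_⟩, ?_, ?_, ?_⟩
  · rw [ew]; exact k1.1
  · intro he
    have hr := (k1.2 (he.trans ew)).1
    refine hfwd hr fun x hx => ?_
    have hfun := eq_of_integral_eq (hG.gauge_cont hn) (hGu.gauge_cont hn) (hG.int_gauge hn)
      (hGu.int_gauge hn) (fun x => gauge_mono (absorbent_nhds_zero (hGu.nhds hn)) hsubZ x)
      (he.trans (hregu hr).1.symm)
    have h1 : gauge (convexHull ℝ (range u)) x ≤ 1 := by
      rw [← hfun]; exact gauge_le_one_of_mem (subset_convexHull ℝ _ hx)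
    have h2 := (gauge_le_one_iff_mem_closure hGu.conv (hGu.nhds hn)).1 h1
    rw [hGu.cpt.isClosed.closure_eq] at h2
    have h3 := le_suppFn hGu.sub x h2
    have h4 : ‖x‖ = 1 := by simpa using hμ.1 hx
    rwa [real_inner_self_eq_norm_sq, h4, one_pow] at h3
  · intro hN
    obtain ⟨hr, hS⟩ := hbwd hN
    rw [hS]; exact (hregu hr).1
  · have := k2.1
    rw [ew] at this
    exact le_of_mul_le_mul_left this hn0
  · intro he
    have hr := (k2.2 (by rw [ew, he])).2
    refine hfwd hr fun x hx => ?_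
    have hfun := eq_of_integral_eq (continuous_suppFn hGu.sub (hGu.nonempty hn))
      (continuous_suppFn hG.sub (hG.nonempty hn)) (hGu.int_supp hn)
      (hG.int_supp hn) (fun x => suppFn_le (hGu.nonempty hn) x
        fun y hy => le_suppFn hG.sub x (hsubZ hy))
      ((hregu hr).2.trans he.symm)
    rw [hfun]
    have h3 := le_suppFn hG.sub x (subset_convexHull ℝ _ hx)
    have h4 : ‖x‖ = 1 := by simpa using hμ.1 hx
    rwa [real_inner_self_eq_norm_sq, h4, one_pow] at h3
  · intro hN
    obtain ⟨hr, hS⟩ := hbwd hN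
    rw [hS]; exact (hregu hr).2

end Regular

end Part7

section Part8
open MeasureTheory Metric Set
open scoped RealInnerProductSpace ENNReal Pointwise
set_option linter.unusedSectionVars false


section Polar
open Filter Topology

variable {n : ℕ} {ι : Type*} [Fintype ι] {u : ι → EE n} {c : ι → ℝ} {Z : Set (EE n)}

lemma gaussianM_eq : gaussianM n = gM (EE n) := by
  unfold gaussianM gM gd
  simp

lemma suppFn_smul {K : Set (EE n)} {r : ℝ} (hr : 0 ≤ r) (x : EE n) :
    suppFn K (r • x) = r * suppFn K x := by
  unfold suppFn
  have : (fun y => ⟪r • x, y⟫) '' K = r • ((fun y => ⟪x, y⟫) '' K) := by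
    ext z
    simp only [Set.mem_image, Set.mem_smul_set, inner_smul_left, conj_trivial, smul_eq_mul]
    constructor
    · rintro ⟨y, hy, rfl⟩; exact ⟨_, ⟨y, hy, rfl⟩, rfl⟩
    · rintro ⟨_, ⟨y, hy, rfl⟩, rfl⟩; exact ⟨y, hy, rfl⟩
  rw [this, Real.sSup_smul_of_nonneg hr, smul_eq_mul]

lemma Good.gauge_polar (hn : 1 ≤ n) (h : Good Z u c) (x : EE n) :
    gauge (polarSet Z) x = suppFn Z x := by
  have hb : closedBall (0 : EE n) 1 ⊆ polarSet Z := by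
    intro y hy z hz
    have h1 := h.sub hz
    rw [mem_closedBall_zero_iff] at hy h1
    calc ⟪y, z⟫ ≤ ‖y‖ * ‖z‖ := real_inner_le_norm _ _
      _ ≤ 1 := mul_le_one₀ hy (norm_nonneg _) h1
  have habs : Absorbent ℝ (polarSet Z) :=
    absorbent_nhds_zero (mem_of_superset (closedBall_mem_nhds _ one_pos) hb)
  apply le_antisymm
  · refine le_of_forall_gt_imp_ge_of_dense fun a ha => ?_
    have ha0 : 0 < a := lt_of_le_of_lt (h.suppFn_nonneg hn x) ha
    refine gauge_le_of_mem ha0.le ⟨a⁻¹ • x, fun y hy => ?_, ?_⟩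
    · rw [inner_smul_left]
      simp only [conj_trivial]
      have := le_suppFn h.sub x hy
      rw [inv_mul_le_iff₀ ha0]; linarith
    · simp [smul_smul, ha0.ne']
  · refine le_of_forall_gt_imp_ge_of_dense fun a ha => ?_
    obtain ⟨b, hb0, hba, y, hy, hyx⟩ := exists_lt_of_gauge_lt habs ha
    refine le_trans ?_ hba.le
    refine suppFn_le (h.nonempty hn) x fun z hz => ?_
    have hyx' : b • y = x := hyx
    rw [← hyx', inner_smul_left]
    simp only [conj_trivial]
    have := hy z hz
    nlinarith

lemma Good.supp_polar (hn : 1 ≤ n) (h : Good Z u c) (x : EE n) :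
    suppFn (polarSet Z) x = gauge Z x := by
  have h0 : (0 : EE n) ∈ polarSet Z := by intro y _; simp
  have hle : ∀ y ∈ polarSet Z, ⟪x, y⟫ ≤ gauge Z x := by
    intro y hy
    refine le_of_forall_gt_imp_ge_of_dense fun a ha => ?_
    obtain ⟨b, hb0, hba, z, hz, hzx⟩ :=
      exists_lt_of_gauge_lt (absorbent_nhds_zero (h.nhds hn)) ha
    refine le_trans ?_ hba.le
    have hzx' : b • z = x := hzx
    rw [← hzx', inner_smul_left, real_inner_comm]
    simp only [conj_trivial]
    have := hy z hz
    nlinarith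
  have hbdd : BddAbove ((fun y => ⟪x, y⟫) '' polarSet Z) := by
    refine ⟨gauge Z x, ?_⟩
    rintro _ ⟨y, hy, rfl⟩; exact hle y hy
  have hge : ∀ y ∈ polarSet Z, ⟪x, y⟫ ≤ suppFn (polarSet Z) x :=
    fun y hy => le_csSup hbdd ⟨y, hy, rfl⟩
  apply le_antisymm
  · exact suppFn_le ⟨0, h0⟩ x hle
  · refine le_of_forall_gt_imp_ge_of_dense fun a ha => ?_
    have ha0 : 0 < a := by
      have := hge 0 h0
      rw [inner_zero_right] at this
      linarith
    refine gauge_le_of_mem ha0.le ⟨a⁻¹ • x, ?_, by simp [smul_smul, ha0.ne']⟩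
    by_contra hx
    obtain ⟨f, s, hfs, hsx⟩ := geometric_hahn_banach_closed_point h.conv h.cpt.isClosed hx
    have hs0 : 0 < s := by simpa using hfs 0 (h.zero_mem hn)
    set y := (InnerProductSpace.toDual ℝ (EE n)).symm f with hy
    have hyf : ∀ z, ⟪y, z⟫ = f z := fun z => InnerProductSpace.toDual_symm_apply
    have hmem : s⁻¹ • y ∈ polarSet Z := by
      intro z hz
      rw [inner_smul_left, hyf]
      simp only [conj_trivial]
      rw [inv_mul_le_iff₀ hs0]
      linarith [hfs z hz]
    have h1 := hge _ hmem
    rw [inner_smul_right, real_inner_comm, hyf, inv_mul_le_iff₀ hs0] at h1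
    rw [map_smul, smul_eq_mul, lt_inv_mul_iff₀ ha0] at hsx
    nlinarith

end Polar

end Part8

section Part9
open MeasureTheory Metric Set
open scoped RealInnerProductSpace ENNReal
set_option linter.unusedSectionVars false


section Sphere
open Filter Topology

variable {m : ℕ}

/-- coordinate projection -/
def prj (i : Fin (m + 1)) (x : EE (m + 1)) : Fin m → ℝ := fun j => x (i.succAbove j)

lemma sphere_sum {x : EE (m + 1)} (hx : x ∈ sphere (0 : EE (m + 1)) 1) (i : Fin (m + 1)) :
    x i ^ 2 + ∑ j, x (i.succAbove j) ^ 2 = 1 := by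
  have h : ‖x‖ ^ 2 = 1 := by
    rw [mem_sphere_zero_iff_norm] at hx; rw [hx, one_pow]
  rw [EuclideanSpace.norm_sq_eq, Fin.sum_univ_succAbove _ i] at h
  simpa using h

/-- a spherical cap -/
def capS (i : Fin (m + 1)) (s : ℝ) : Set (EE (m + 1)) :=
  {x | x ∈ sphere (0 : EE (m + 1)) 1 ∧ 1 / ((m : ℝ) + 1) ≤ s * x i}

lemma norm_le_sum (x : EE (m + 1)) : ‖x‖ ≤ ∑ i, |x i| := by
  have h1 : ‖x‖ ^ 2 ≤ (∑ i, |x i|) ^ 2 := by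
    rw [EuclideanSpace.norm_sq_eq]
    exact Finset.sum_sq_le_sq_sum_of_nonneg fun i _ => norm_nonneg _
  exact (sq_le_sq₀ (norm_nonneg _) (Finset.sum_nonneg fun i _ => abs_nonneg _)).1 h1

lemma sphere_cover : sphere (0 : EE (m + 1)) 1 ⊆ ⋃ i, (capS i 1 ∪ capS i (-1)) := by
  intro x hx
  have hx1 : ‖x‖ = 1 := by simpa using hx
  obtain ⟨i, hi⟩ : ∃ i, 1 / ((m : ℝ) + 1) ≤ |x i| := by
    by_contra! h
    have h1 : ∑ i, |x i| < ∑ _i : Fin (m + 1), 1 / ((m : ℝ) + 1) :=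
      Finset.sum_lt_sum_of_nonempty Finset.univ_nonempty fun i _ => h i
    rw [Finset.sum_const, Finset.card_univ, Fintype.card_fin, nsmul_eq_mul] at h1
    push_cast at h1
    rw [mul_one_div_cancel (by positivity)] at h1
    linarith [norm_le_sum x]
  rw [mem_iUnion]
  refine ⟨i, ?_⟩
  rcases le_total 0 (x i) with h | h
  · left; exact ⟨hx, by rw [abs_of_nonneg h] at hi; linarith⟩
  · right; exact ⟨hx, by rw [abs_of_nonpos h] at hi; linarith⟩

lemma abs_coord_le {x : EE (m + 1)} (hx : x ∈ sphere (0 : EE (m + 1)) 1) (i) : |x i| ≤ 1 := by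
  have := PiLp.norm_apply_le x i
  rw [mem_sphere_zero_iff_norm.1 hx] at this
  exact this

lemma cap_antilip {i : Fin (m + 1)} {s : ℝ} (hs : s = 1 ∨ s = -1) {x y : EE (m + 1)}
    (hx : x ∈ capS i s) (hy : y ∈ capS i s) :
    dist x y ≤ ((m : ℝ) + 1) ^ 3 * dist (prj i x) (prj i y) := by
  set D := dist (prj i x) (prj i y) with hD
  have hD0 : 0 ≤ D := dist_nonneg
  set M : ℝ := (m : ℝ) + 1 with hM
  have hM1 : 1 ≤ M := by rw [hM]; linarith [(Nat.cast_nonneg m : (0:ℝ) ≤ m)]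
  have hj : ∀ j, |x (i.succAbove j) - y (i.succAbove j)| ≤ D := fun j => by
    have := dist_le_pi_dist (prj i x) (prj i y) j
    exact this
  have hi : |x i - y i| ≤ M ^ 2 * D := by
    have h1 := sphere_sum hx.1 i
    have h2 := sphere_sum hy.1 i
    have h3 : (x i - y i) * (x i + y i)
        = ∑ j, (y (i.succAbove j) ^ 2 - x (i.succAbove j) ^ 2) := by
      rw [Finset.sum_sub_distrib]; linarith
    have h4 : |(x i - y i) * (x i + y i)| ≤ m * (2 * D) := by
      rw [h3]
      refine (Finset.abs_sum_le_sum_abs _ _).trans ?_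
      have : ∀ j ∈ (Finset.univ : Finset (Fin m)),
          |y (i.succAbove j) ^ 2 - x (i.succAbove j) ^ 2| ≤ 2 * D := by
        intro j _
        have e : y (i.succAbove j) ^ 2 - x (i.succAbove j) ^ 2
          = -((x (i.succAbove j) - y (i.succAbove j)) * (x (i.succAbove j) + y (i.succAbove j))) := by
          ring
        rw [e, abs_neg, abs_mul, mul_comm]
        have a1 := abs_coord_le hx.1 (i.succAbove j)
        have a2 := abs_coord_le hy.1 (i.succAbove j)
        have a3 := abs_add_le (x (i.succAbove j)) (y (i.succAbove j))
        exact mul_le_mul (by linarith) (hj j) (abs_nonneg _) (by norm_num)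
      refine (Finset.sum_le_sum this).trans ?_
      simp
    have h5 : 2 / M ≤ |x i + y i| := by
      have b1 := hx.2
      have b2 := hy.2
      have : 2 / M ≤ s * (x i + y i) := by
        rw [mul_add]; calc 2 / M = 1 / M + 1 / M := by ring
          _ ≤ _ := add_le_add b1 b2
      rcases hs with rfl | rfl
      · exact this.trans (by rw [one_mul]; exact le_abs_self _)
      · exact this.trans (by rw [neg_one_mul]; exact neg_le_abs _)
    rw [abs_mul] at h4
    have h6 : |x i - y i| * (2 / M) ≤ m * (2 * D) :=
      (mul_le_mul_of_nonneg_left h5 (abs_nonneg _)).trans h4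
    have hMp : 0 < M := by linarith
    rw [mul_div_assoc', div_le_iff₀ hMp] at h6
    have h7 : (m : ℝ) ≤ M := by rw [hM]; linarith
    have h8 : (m : ℝ) * D * M ≤ M * D * M := by gcongr
    nlinarith
  rw [dist_eq_norm]
  refine (norm_le_sum _).trans ?_
  have : ∀ k ∈ (Finset.univ : Finset (Fin (m + 1))), |(x - y) k| ≤ M ^ 2 * D := by
    intro k _
    rcases Fin.eq_self_or_eq_succAbove i k with rfl | ⟨j, rfl⟩
    · simpa using hi
    · have h1 := hj j
      have h2 : D ≤ M ^ 2 * D := le_mul_of_one_le_left hD0 (one_le_pow₀ hM1)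
      simpa using h1.trans h2
  refine (Finset.sum_le_sum this).trans ?_
  rw [Finset.sum_const, Finset.card_univ, Fintype.card_fin, nsmul_eq_mul]
  push_cast
  rw [← hM]
  apply le_of_eq; ring

lemma cap_finite (i : Fin (m + 1)) {s : ℝ} (hs : s = 1 ∨ s = -1) :
    μH[(m : ℝ)] (capS i s) < ⊤ := by
  set g := Function.invFunOn (prj i) (capS i s) with hg
  have h1 : ∀ y ∈ prj i '' capS i s, g y ∈ capS i s ∧ prj i (g y) = y := fun y hy =>
    ⟨Function.invFunOn_mem hy, Function.invFunOn_eq hy⟩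
  have hlip : LipschitzOnWith (Real.toNNReal (((m : ℝ) + 1) ^ 3)) g (prj i '' capS i s) := by
    refine LipschitzOnWith.of_dist_le_mul fun y hy z hz => ?_
    rw [Real.coe_toNNReal _ (by positivity)]
    have := cap_antilip hs (h1 y hy).1 (h1 z hz).1
    rwa [(h1 y hy).2, (h1 z hz).2] at this
  have hsub : capS i s ⊆ g '' (prj i '' capS i s) := by
    intro x hx
    have hy : prj i x ∈ prj i '' capS i s := ⟨x, hx, rfl⟩
    refine ⟨prj i x, hy, ?_⟩
    have h2 := cap_antilip hs (h1 _ hy).1 hx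
    rw [(h1 _ hy).2, dist_self, mul_zero] at h2
    exact dist_le_zero.1 h2
  have h2 := hlip.hausdorffMeasure_image_le (d := (m : ℝ)) (by positivity)
  refine lt_of_le_of_lt ((measure_mono hsub).trans h2) ?_
  refine ENNReal.mul_lt_top (ENNReal.rpow_lt_top_of_nonneg (by positivity) (by simp)) ?_
  have h3 : (μH[(m : ℝ)] : Measure (Fin m → ℝ)) = volume := by
    have := hausdorffMeasure_pi_real (ι := Fin m)
    rwa [Fintype.card_fin] at this
  rw [h3]
  refine lt_of_le_of_lt (measure_mono (t := closedBall 0 1) ?_)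
    (isCompact_closedBall (0 : Fin m → ℝ) 1).measure_lt_top
  rintro _ ⟨x, hx, rfl⟩
  rw [mem_closedBall_zero_iff, pi_norm_le_iff_of_nonneg zero_le_one]
  intro j
  exact abs_coord_le hx.1 _

lemma sphere_finite : μH[(m : ℝ)] (sphere (0 : EE (m + 1)) 1) < ⊤ := by
  refine lt_of_le_of_lt (measure_mono sphere_cover) ?_
  refine lt_of_le_of_lt (measure_iUnion_fintype_le _ _) ?_
  rw [ENNReal.sum_lt_top]
  intro i _
  exact lt_of_le_of_lt (measure_union_le _ _)
    (ENNReal.add_lt_top.2 ⟨cap_finite i (Or.inl rfl), cap_finite i (Or.inr rfl)⟩)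

lemma sphere_pos : 0 < μH[(m : ℝ)] (sphere (0 : EE (m + 1)) 1) := by
  have hlip : LipschitzWith 1 (prj (0 : Fin (m + 1))) := by
    refine LipschitzWith.of_dist_le_mul fun x y => ?_
    rw [NNReal.coe_one, one_mul, dist_pi_le_iff dist_nonneg]
    intro j
    rw [dist_eq_norm x y]
    exact PiLp.norm_apply_le (x - y) _
  have h2 := (hlip.lipschitzOnWith (s := sphere (0 : EE (m + 1)) 1)).hausdorffMeasure_image_le
    (d := (m : ℝ)) (by positivity)
  have h3 : (μH[(m : ℝ)] : Measure (Fin m → ℝ)) = volume := by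
    have := hausdorffMeasure_pi_real (ι := Fin m)
    rwa [Fintype.card_fin] at this
  rw [h3] at h2
  simp only [ENNReal.coe_one, ENNReal.one_rpow, one_mul] at h2
  refine lt_of_lt_of_le ?_ h2
  have hp : (0:ℝ) < 1 / ((m : ℝ) + 1) := by positivity
  refine lt_of_lt_of_le (measure_closedBall_pos volume (0 : Fin m → ℝ) hp) (measure_mono ?_)
  intro y hy
  rw [mem_closedBall_zero_iff, pi_norm_le_iff_of_nonneg hp.le] at hy
  have hsum : ∑ j, y j ^ 2 ≤ 1 := by
    have : ∀ j ∈ (Finset.univ : Finset (Fin m)), y j ^ 2 ≤ 1 / ((m : ℝ) + 1) := by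
      intro j _
      have h1 := hy j
      rw [Real.norm_eq_abs] at h1
      have h2 : 1 / ((m : ℝ) + 1) ≤ 1 := by
        rw [div_le_one (by positivity)]; linarith [(Nat.cast_nonneg m : (0:ℝ) ≤ m)]
      rw [← sq_abs]
      nlinarith [abs_nonneg (y j)]
    refine (Finset.sum_le_sum this).trans ?_
    rw [Finset.sum_const, Finset.card_univ, Fintype.card_fin, nsmul_eq_mul, mul_one_div,
      div_le_one (by positivity)]
    linarith
  refine ⟨WithLp.toLp 2 (Fin.cons (√(1 - ∑ j, y j ^ 2)) y), ?_, ?_⟩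
  · rw [mem_sphere_zero_iff_norm]
    have : ‖(WithLp.toLp 2 (Fin.cons (√(1 - ∑ j, y j ^ 2)) y) : EE (m + 1))‖ ^ 2 = 1 := by
      rw [EuclideanSpace.norm_sq_eq, Fin.sum_univ_succ]
      simp [Real.sq_sqrt (sub_nonneg.2 hsum)]
    nlinarith [norm_nonneg (WithLp.toLp 2 (Fin.cons (√(1 - ∑ j, y j ^ 2)) y) : EE (m + 1))]
  · funext j
    simp [prj]

end Sphere

end Part9

section Part10
open MeasureTheory Metric Set
open scoped RealInnerProductSpace ENNReal
set_option linter.unusedSectionVars false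


section Rot
open Filter Topology

variable {V : Type*} [NormedAddCommGroup V] [InnerProductSpace ℝ V] [FiniteDimensional ℝ V]
  [MeasurableSpace V] [BorelSpace V]

/-- rotation invariance of a measure -/
def RotInv (σ : Measure V) : Prop := ∀ L : V ≃ₗᵢ[ℝ] V, MeasurePreserving L σ σ

lemma RotInv.charFun_eq {σ : Measure V} (h : RotInv σ) {s t : V} (hst : ‖s‖ = ‖t‖) :
    charFun σ s = charFun σ t := by
  set L := (ℝ ∙ (t - s))ᗮ.reflection with hL
  have hLs : L t = s := Submodule.reflection_sub hst.symm
  rw [charFun_apply, charFun_apply, ← (h L).integral_comp L.toHomeomorph.measurableEmbedding]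
  refine integral_congr_ae (ae_of_all _ fun x => ?_)
  have : ⟪L x, s⟫ = ⟪x, t⟫ := by rw [← hLs, LinearIsometryEquiv.inner_map_map]
  simp only [this]

lemma rot_unique {σ ν : Measure V} [IsFiniteMeasure σ] [IsFiniteMeasure ν]
    (hσ : RotInv σ) (hν : RotInv ν) (hσ1 : ∀ᵐ x ∂σ, ‖x‖ = 1) (hν1 : ∀ᵐ x ∂ν, ‖x‖ = 1) :
    ν univ • σ = σ univ • ν := by
  have key : ∀ (t : V), (ν.real univ : ℂ) * charFun σ t = (σ.real univ : ℂ) * charFun ν t := by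
    intro t
    have e1 : ∀ (α β : Measure V) [IsFiniteMeasure α] [IsFiniteMeasure β], RotInv α →
        (∀ᵐ x ∂β, ‖x‖ = 1) → (β.real univ : ℂ) * charFun α t
          = ∫ y, ∫ x, Complex.exp ((‖t‖ * ⟪x, y⟫ : ℝ) * Complex.I) ∂α ∂β := by
      intro α β _ _ hα hβ
      have : ∀ᵐ y ∂β, ∫ x, Complex.exp ((‖t‖ * ⟪x, y⟫ : ℝ) * Complex.I) ∂α = charFun α t := by
        filter_upwards [hβ] with y hy
        rw [hα.charFun_eq (s := t) (t := ‖t‖ • y) (by rw [norm_smul, hy]; simp), charFun_apply]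
        simp only [inner_smul_right]
      rw [integral_congr_ae this]
      simp
    rw [e1 σ ν hσ hν1, e1 ν σ hν hσ1, integral_integral_swap]
    · refine integral_congr_ae (ae_of_all _ fun x => integral_congr_ae (ae_of_all _ fun y => ?_))
      simp only [real_inner_comm]
    · refine Integrable.of_bound (C := 1) ?_ (ae_of_all _ fun p => ?_)
      · apply Continuous.aestronglyMeasurable
        unfold Function.uncurry
        fun_prop
      · rw [Function.uncurry, Complex.norm_exp_ofReal_mul_I]
  have f1 : IsFiniteMeasure (ν univ • σ) := σ.smul_finite (measure_ne_top _ _)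
  have f2 : IsFiniteMeasure (σ univ • ν) := ν.smul_finite (measure_ne_top _ _)
  refine Measure.ext_of_charFun ?_
  funext t
  rw [charFun_apply, charFun_apply, integral_smul_measure, integral_smul_measure,
    ← charFun_apply, ← charFun_apply, Complex.real_smul, Complex.real_smul]
  exact key t

lemma RotInv.withDensity {σ : Measure V} (h : RotInv σ) {g : V → ℝ≥0∞} (hg : Measurable g)
    (hr : ∀ (L : V ≃ₗᵢ[ℝ] V) x, g (L x) = g x) : RotInv (σ.withDensity g) := by
  intro L
  have hm : Measurable L := L.continuous.measurable
  refine ⟨hm, ?_⟩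
  ext s hs
  rw [Measure.map_apply hm hs, withDensity_apply _ (hm hs), withDensity_apply _ hs,
    ← (h L).setLIntegral_comp_preimage hs hg]
  simp only [hr]

lemma rot_gM : RotInv (gM V) := by
  refine RotInv.withDensity (fun L => L.measurePreserving) ?_ ?_
  · exact (continuous_gd.measurable).ennreal_ofReal
  · intro L x
    simp [gd]

/-- radial projection -/
def rad (x : V) : V := ‖x‖⁻¹ • x

lemma measurable_rad : Measurable (rad : V → V) := by unfold rad; fun_prop

/-- the radial push-forward of the Gaussian measure -/
def radM (V : Type*) [NormedAddCommGroup V] [InnerProductSpace ℝ V] [FiniteDimensional ℝ V]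
    [MeasurableSpace V] [BorelSpace V] : Measure V :=
  ((gM V).withDensity fun x => ((‖x‖₊ : NNReal) : ℝ≥0∞)).map rad

instance : IsFiniteMeasure ((gM V).withDensity fun x => ((‖x‖₊ : NNReal) : ℝ≥0∞)) := by
  refine isFiniteMeasure_withDensity ?_
  have := (integrable_norm_gM (V := V)).2
  rw [hasFiniteIntegral_iff_enorm] at this
  simp only [enorm_norm] at this
  exact this.ne

instance : IsFiniteMeasure (radM V) := by unfold radM; infer_instance

lemma rot_radM : RotInv (radM V) := by
  intro L
  have hm : Measurable L := L.continuous.measurable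
  refine ⟨hm, ?_⟩
  have h := (rot_gM (V := V)).withDensity (g := fun x => ((‖x‖₊ : NNReal) : ℝ≥0∞))
    (by fun_prop) (fun L x => by simp) L
  unfold radM
  rw [Measure.map_map hm measurable_rad]
  conv_rhs => rw [← h.map_eq]
  rw [Measure.map_map measurable_rad hm]
  congr 1
  funext x
  simp [rad]

lemma gM_ac : gM V ≪ (volume : Measure V) := withDensity_absolutelyContinuous _ _

lemma gM_ne_zero [Nontrivial V] : ∀ᵐ x ∂(gM V), x ≠ 0 :=
  gM_ac.ae_le (compl_mem_ae_iff.2 (measure_singleton (0 : V)))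

lemma radM_norm [Nontrivial V] : ∀ᵐ x ∂(radM V), ‖x‖ = 1 := by
  unfold radM
  rw [ae_map_iff measurable_rad.aemeasurable
    (measurableSet_eq_fun measurable_norm measurable_const)]
  filter_upwards [(withDensity_absolutelyContinuous _ _).ae_le (gM_ne_zero (V := V))] with x hx
  rw [rad, norm_smul, norm_inv, norm_norm, inv_mul_cancel₀ (norm_ne_zero_iff.2 hx)]

lemma integral_radM {f : V → ℝ} (hf : Continuous f)
    (hr : ∀ (r : ℝ) x, 0 ≤ r → f (r • x) = r * f x) :
    ∫ x, f x ∂(radM V) = ∫ x, f x ∂(gM V) := by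
  unfold radM
  rw [integral_map measurable_rad.aemeasurable hf.aestronglyMeasurable,
    integral_withDensity_eq_integral_smul (by fun_prop)]
  refine integral_congr_ae (ae_of_all _ fun x => ?_)
  have h0 : f 0 = 0 := by simpa using hr 0 0 le_rfl
  by_cases hx : x = 0
  · simp [hx, rad, h0]
  · have : ‖x‖ ≠ 0 := norm_ne_zero_iff.2 hx
    simp only [rad]
    rw [hr _ _ (by positivity), NNReal.smul_def, coe_nnnorm, smul_eq_mul, ← mul_assoc,
      mul_inv_cancel₀ this, one_mul]

lemma radM_pos [Nontrivial V] : 0 < (radM V) univ := by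
  rw [pos_iff_ne_zero]
  intro h
  rw [radM, Measure.map_apply measurable_rad MeasurableSet.univ, preimage_univ,
    withDensity_apply _ MeasurableSet.univ, Measure.restrict_univ,
    lintegral_eq_zero_iff (by fun_prop)] at h
  have h2 : ∀ᵐ _x ∂(gM V), False := by
    filter_upwards [h, gM_ne_zero (V := V)] with x h1 h2
    simp at h1
    exact h2 h1
  rw [ae_iff] at h2
  simp at h2

variable {m : ℕ}

lemma rot_sphere (d : ℝ) : RotInv ((μH[d] : Measure V).restrict (sphere (0 : V) 1)) := by
  intro L
  have h := (L.toIsometryEquiv.measurePreserving_hausdorffMeasure d).restrict_preimage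
    (s := sphere (0 : V) 1) isClosed_sphere.measurableSet
  have e : (L.toIsometryEquiv : V → V) ⁻¹' sphere (0 : V) 1 = sphere (0 : V) 1 := by
    ext x; simp
  rw [e] at h
  exact h

lemma sphere_gauss (m : ℕ) : ∃ κ : ℝ, 0 < κ ∧ ∀ f : EE (m + 1) → ℝ, Continuous f →
    (∀ (r : ℝ) x, 0 ≤ r → f (r • x) = r * f x) →
    ∫ x in sphere (0 : EE (m + 1)) 1, f x ∂μH[(m : ℝ)] = κ * ∫ x, f x ∂(gM (EE (m + 1))) := by
  set σ := (μH[(m : ℝ)] : Measure (EE (m + 1))).restrict (sphere (0 : EE (m + 1)) 1) with hσ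
  have hfin : IsFiniteMeasure σ := ⟨by rw [hσ, Measure.restrict_apply_univ]; exact sphere_finite⟩
  have hpos : 0 < σ univ := by rw [hσ, Measure.restrict_apply_univ]; exact sphere_pos
  have hs1 : ∀ᵐ x ∂σ, ‖x‖ = 1 := by
    filter_upwards [ae_restrict_mem isClosed_sphere.measurableSet] with x hx
    simpa using hx
  have h := rot_unique (rot_sphere (m : ℝ)) (rot_radM (V := EE (m + 1))) hs1 radM_norm
  have p1 : 0 < (σ univ).toReal := ENNReal.toReal_pos hpos.ne' (measure_ne_top _ _)
  have p2 : 0 < (radM (EE (m + 1)) univ).toReal :=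
    ENNReal.toReal_pos radM_pos.ne' (measure_ne_top _ _)
  refine ⟨(σ univ).toReal / (radM (EE (m + 1)) univ).toReal, by positivity, fun f hf hr => ?_⟩
  have h2 := congrArg (fun μ : Measure (EE (m + 1)) => ∫ x, f x ∂μ) h
  simp only [integral_smul_measure, smul_eq_mul] at h2
  rw [integral_radM hf hr] at h2
  rw [div_mul_eq_mul_div, eq_div_iff p2.ne', mul_comm]
  exact h2

end Rot

end Part10


section Final
open Filter Topology

lemma meanWidth_eq {n : ℕ} (hn : 1 ≤ n) : ∃ C : ℝ, 0 < C ∧ ∀ K : Set (EE n),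
    Continuous (suppFn K) → meanWidth n K = C * ∫ x, suppFn K x ∂(gM (EE n)) := by
  obtain ⟨m, rfl⟩ : ∃ m, n = m + 1 := ⟨n - 1, by omega⟩
  obtain ⟨κ, hκ, h⟩ := sphere_gauss m
  have hv : 0 < (volume (closedBall (0 : EE (m + 1)) 1)).toReal :=
    ENNReal.toReal_pos (measure_closedBall_pos _ _ one_pos).ne'
      (isCompact_closedBall _ _).measure_ne_top
  set v := (volume (closedBall (0 : EE (m + 1)) 1)).toReal with hvd
  refine ⟨1 / (((m + 1 : ℕ) : ℝ) * v) * κ * 2,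
    by positivity, fun K hK => ?_⟩
  have hd : ((m + 1 : ℕ) : ℝ) - 1 = m := by push_cast; ring
  have hKn : Continuous fun x => suppFn K (-x) := hK.comp continuous_neg
  obtain ⟨B, hB⟩ := (isCompact_sphere (0 : EE (m + 1)) 1).exists_bound_of_continuousOn
    hK.continuousOn
  have hbd : ∀ x, |suppFn K x| ≤ B * ‖x‖ := by
    intro x
    by_cases hx : x = 0
    · have := suppFn_smul (K := K) (r := 0) le_rfl x
      simp only [zero_smul, zero_mul] at this
      simp [hx, this]
    · have hx' : 0 < ‖x‖ := norm_pos_iff.2 hx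
      have h1 := hB (‖x‖⁻¹ • x) (by simp [norm_smul, hx'.ne'])
      have h2 : suppFn K x = ‖x‖ * suppFn K (‖x‖⁻¹ • x) := by
        rw [← suppFn_smul hx'.le, smul_inv_smul₀ hx'.ne']
      rw [h2, abs_mul, abs_norm, mul_comm]
      exact mul_le_mul_of_nonneg_right h1 hx'.le
  have hi : Integrable (suppFn K) (gM (EE (m + 1))) := integrable_of_bound hK hbd
  have hi2 : Integrable (fun x => suppFn K (-x)) (gM (EE (m + 1))) :=
    integrable_of_bound (C := B) hKn fun x => by simpa using hbd (-x)
  have e := h (fun x => suppFn K x + suppFn K (-x)) (hK.add hKn) (fun r x hr => by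
    rw [← smul_neg, suppFn_smul hr, suppFn_smul hr, mul_add])
  rw [integral_add hi hi2, integral_gM_neg _ hK] at e
  unfold meanWidth
  rw [hd, e]
  ring

lemma mul_cmp {C a b : ℝ} {P : Prop} (hC : 0 < C) (h : a ≤ b ∧ (a = b ↔ P)) :
    C * a ≤ C * b ∧ (C * a = C * b ↔ P) :=
  ⟨mul_le_mul_of_nonneg_left h.1 hC.le, by rw [mul_right_inj' hC.ne']; exact h.2⟩

lemma mul_cmp' {C a b : ℝ} {P : Prop} (hC : 0 < C) (h : a ≤ b ∧ (b = a ↔ P)) :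
    C * a ≤ C * b ∧ (C * b = C * a ↔ P) :=
  ⟨mul_le_mul_of_nonneg_left h.1 hC.le, by rw [mul_right_inj' hC.ne']; exact h.2⟩

end Final

theorem li_leng_isotropic
    (n : ℕ) (hn : 1 ≤ n) (μ : Measure (EuclideanSpace ℝ (Fin n)))
    (hμ : IsCenteredIsotropic μ)
    (w : Fin (n + 1) → EuclideanSpace ℝ (Fin n)) (hw : IsRegVerts w) :
    (ellNorm n (convexHull ℝ (msupp μ)) ≤ ellNorm n (convexHull ℝ (Set.range w)) ∧
      (ellNorm n (convexHull ℝ (msupp μ)) = ellNorm n (convexHull ℝ (Set.range w)) ↔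
        (msupp μ).ncard = n + 1)) ∧
    (meanWidth n (polarSet (convexHull ℝ (msupp μ))) ≤
        meanWidth n (polarSet (convexHull ℝ (Set.range w))) ∧
      (meanWidth n (polarSet (convexHull ℝ (msupp μ))) =
          meanWidth n (polarSet (convexHull ℝ (Set.range w))) ↔
        (msupp μ).ncard = n + 1)) ∧
    (ellNorm n (polarSet (convexHull ℝ (Set.range w))) ≤
        ellNorm n (polarSet (convexHull ℝ (msupp μ))) ∧
      (ellNorm n (polarSet (convexHull ℝ (msupp μ))) =
          ellNorm n (polarSet (convexHull ℝ (Set.range w))) ↔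
        (msupp μ).ncard = n + 1)) ∧
    (meanWidth n (convexHull ℝ (Set.range w)) ≤ meanWidth n (convexHull ℝ (msupp μ)) ∧
      (meanWidth n (convexHull ℝ (msupp μ)) = meanWidth n (convexHull ℝ (Set.range w)) ↔
        (msupp μ).ncard = n + 1)) := by
  obtain ⟨h1, h2⟩ := compare_measure hn hμ hw
  obtain ⟨C, hC, hW⟩ := meanWidth_eq hn
  obtain ⟨ι, _, u, c, hinj, hmem, hd, hcen⟩ := exists_family hn hμ
  have hG : Good (convexHull ℝ (msupp μ)) u c := good_hull hd hcen (msupp_compact hμ) hμ.1 hmem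
  obtain ⟨hdw, hcw, -⟩ := regVerts_decomp hn hw
  have hGw := good_range hdw hcw
  have pol1 : suppFn (polarSet (convexHull ℝ (msupp μ))) = gauge (convexHull ℝ (msupp μ)) :=
    funext (hG.supp_polar hn)
  have pol2 : suppFn (polarSet (convexHull ℝ (range w))) = gauge (convexHull ℝ (range w)) :=
    funext (hGw.supp_polar hn)
  have pol3 : gauge (polarSet (convexHull ℝ (msupp μ))) = suppFn (convexHull ℝ (msupp μ)) :=
    funext (hG.gauge_polar hn)
  have pol4 : gauge (polarSet (convexHull ℝ (range w))) = suppFn (convexHull ℝ (range w)) :=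
    funext (hGw.gauge_polar hn)
  have c1 := continuous_suppFn hG.sub (hG.nonempty hn)
  have c2 := continuous_suppFn hGw.sub (hGw.nonempty hn)
  have c3 := hG.gauge_cont hn
  have c4 := hGw.gauge_cont hn
  refine ⟨?_, ?_, ?_, ?_⟩
  · simp only [ellNorm, gaussianM_eq]; exact h1
  · rw [hW _ (pol1 ▸ c3), hW _ (pol2 ▸ c4), pol1, pol2]; exact mul_cmp hC h1
  · simp only [ellNorm, gaussianM_eq, pol3, pol4]; exact h2
  · rw [hW _ c1, hW _ c2]; exact mul_cmp' hC h2

end
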